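/- arXiv:1606.02328 — 2 statements merged into one kernel-verified Lean document; each statement's English description precedes it below -/
import Mathlib

section
/- Let X be a nested almost convex set with exactly k convex layers and let ψ be a nested, adoptable labeling of X. Then ψ is well laid; that is, for every labeled node u with R_k(u) ≠ R_k, the point x_u lies in both conv{previous[R_k(u)], first[R_k(u)], last[R_k(u)]} and conv{first[R_k(u)], last[R_k(u)], next[R_k(u)]}. -/
open Set

noncomputable section

/-- Points of the plane. -/
abbrev Pt : Type := ℝ × ℝ

/-- The orientation determinant of the triple `(a, b, c)`:
`c` lies strictly to the left of the directed line from `a` to `b` iff `orient a b c > 0`. -/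
def orient (a b c : Pt) : ℝ :=
  (b.1 - a.1) * (c.2 - a.2) - (b.2 - a.2) * (c.1 - a.1)

/-- A set of points is in general position if no three pairwise distinct points are collinear. -/
def GenPos (X : Set Pt) : Prop :=
  ∀ a ∈ X, ∀ b ∈ X, ∀ c ∈ X, a ≠ b → a ≠ c → b ≠ c → orient a b c ≠ 0

/-- The set of extreme points of the convex hull of `S`. -/
def extremePts (S : Set Pt) : Set Pt := Set.extremePoints ℝ (convexHull ℝ S)

/-- Remove the extreme points of the convex hull (one peeling step of convex layers). -/
def peel (S : Set Pt) : Set Pt := S \ extremePts S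

/-- `X` has exactly `k` convex layers. -/
def HasLayers (X : Set Pt) (k : ℕ) : Prop :=
  peel^[k] X = ∅ ∧ ∀ j < k, peel^[j] X ≠ ∅

/-- `X_j`, the union of the `j` innermost convex layers (when `X` has `k` layers). -/
def layerSub (X : Set Pt) (k j : ℕ) : Set Pt := peel^[k - j] X

/-- `R_j`, the `j`-th convex layer of `X` (when `X` has `k` layers), `R_1` innermost. -/
def layer (X : Set Pt) (k j : ℕ) : Set Pt := extremePts (layerSub X k j)

/-- `X` is a nested almost convex set. -/
def IsNACS (X : Set Pt) : Prop :=
  X.Finite ∧ X.Nonempty ∧ GenPos X ∧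
  ∀ k, HasLayers X k →
    ∀ j, 1 ≤ j → j ≤ k →
      ∀ a ∈ layer X k j, ∀ b ∈ layer X k j, ∀ c ∈ layer X k j,
        a ≠ b → a ≠ c → b ≠ c →
        ∃! p : Pt, p ∈ layerSub X k (j - 1) ∩ interior (convexHull ℝ ({a, b, c} : Set Pt))

/-- `q` is a counterclockwise enumeration of `S`. -/
def CCWEnum {m : ℕ} (S : Set Pt) (q : Fin m → Pt) : Prop :=
  Function.Injective q ∧ Set.range q = S ∧
  ∀ a b c : Fin m, a < b → b < c → 0 < orient (q a) (q b) (q c)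

/-- The ordered pair `(q1, q2)` of points of `R` is adoptable from `p`. -/
def AdoptablePair (R : Set Pt) (p q1 q2 : Pt) : Prop :=
  ∀ q3 ∈ R \ ({q1, q2} : Set Pt), p ∈ interior (convexHull ℝ ({q1, q2, q3} : Set Pt))

/-- The `i`-th binary string of length `j` in lexicographic order (`false` before `true`). -/
def strOfNat (j i : ℕ) : List Bool :=
  (List.range j).map fun t => i.testBit (j - 1 - t)

/-- The numeric (lexicographic) rank of a binary string among strings of its length. -/
def natOfStr (s : List Bool) : ℕ := s.foldl (fun n b => 2 * n + b.toNat) 0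

/-- The leftmost `k`-level descendant of the node `s`. -/
def firstStr (k : ℕ) (s : List Bool) : List Bool := s ++ List.replicate (k - s.length) false

/-- The rightmost `k`-level descendant of the node `s`. -/
def lastStr (k : ℕ) (s : List Bool) : List Bool := s ++ List.replicate (k - s.length) true

/-- Non-root nodes of the tree `T₁(k)`: binary strings of length `1..k`. -/
def ValidNode1 (k : ℕ) (s : List Bool) : Prop := 1 ≤ s.length ∧ s.length ≤ k

/-- A type-1 labeling of `X`, given by its label function `x` (the inverse of `ψ`). -/
def IsLabeling1 (k : ℕ) (X : Set Pt) (x : List Bool → Pt) : Prop :=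
  Set.InjOn x {s | ValidNode1 k s} ∧ x '' {s | ValidNode1 k s} = X

/-- A type-1 labeling is nested. -/
def Nested1 (k : ℕ) (X : Set Pt) (x : List Bool → Pt) : Prop :=
  ∀ j, 1 ≤ j → j ≤ k →
    CCWEnum (layer X k j) fun i : Fin (2 ^ j) => x (strOfNat j i.val)

/-- A type-1 labeling is adoptable. -/
def Adoptable1 (k : ℕ) (X : Set Pt) (x : List Bool → Pt) : Prop :=
  ∀ s : List Bool, 1 ≤ s.length → s.length + 1 ≤ k →
    AdoptablePair (layer X k (s.length + 1)) (x s) (x (s ++ [false])) (x (s ++ [true]))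

/-- `previous[R_k(u)]` for a type-1 labeling: the cyclic predecessor (in the left-to-right,
i.e. counterclockwise, order of the `k`-level) of `first[R_k(u)]`. -/
def prev1 (k : ℕ) (x : List Bool → Pt) (s : List Bool) : Pt :=
  x (strOfNat k ((natOfStr (firstStr k s) + (2 ^ k - 1)) % 2 ^ k))

/-- `next[R_k(u)]` for a type-1 labeling: the cyclic successor of `last[R_k(u)]`. -/
def next1 (k : ℕ) (x : List Bool → Pt) (s : List Bool) : Pt :=
  x (strOfNat k ((natOfStr (lastStr k s) + 1) % 2 ^ k))

/-- A type-1 labeling is well laid. -/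
def WellLaid1 (k : ℕ) (x : List Bool → Pt) : Prop :=
  ∀ s : List Bool, 1 ≤ s.length → s.length ≤ k →
    x s ∈ convexHull ℝ ({prev1 k x s, x (firstStr k s), x (lastStr k s)} : Set Pt) ∧
    x s ∈ convexHull ℝ ({x (firstStr k s), x (lastStr k s), next1 k x s} : Set Pt)

/-- `X_u` for a type-1 labeling: the labels of the proper descendants of `s`. -/
def descSet1 (k : ℕ) (x : List Bool → Pt) (s : List Bool) : Set Pt :=
  x '' {t | ValidNode1 k t ∧ s <+: t ∧ s ≠ t}

/-- `X̄_u = X_u ∪ {x_u}` for a type-1 labeling. -/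
def barSet1 (k : ℕ) (x : List Bool → Pt) (s : List Bool) : Set Pt :=
  insert (x s) (descSet1 k x s)

/-- A type-1 labeling is an internal separation. -/
def InternalSep1 (k : ℕ) (X : Set Pt) (x : List Bool → Pt) : Prop :=
  ∀ s : List Bool, s.length + 1 ≤ k →
    ∀ y ∈ X \ descSet1 k x s,
      ∀ a ∈ barSet1 k x (s ++ [false]), ∀ b ∈ barSet1 k x (s ++ [true]),
        0 < orient a b y

/-- A type-1 labeling is an external separation. -/
def ExternalSep1 (k : ℕ) (X : Set Pt) (x : List Bool → Pt) : Prop :=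
  ∀ s : List Bool, 1 ≤ s.length → s.length + 1 ≤ k →
    ∀ y ∈ X \ barSet1 k x s,
      (∀ a ∈ barSet1 k x (s ++ [false]), 0 < orient a (x s) y) ∧
      (∀ b ∈ barSet1 k x (s ++ [true]), 0 < orient (x s) b y)

/-- Nodes of the tree `T₂(k)`: the root `none`, and pairs `(c, s)`. -/
abbrev Node2 : Type := Option (Fin 3 × List Bool)

/-- Valid nodes of `T₂(k)`: the root, and pairs `(c, s)` with `|s| ≤ k - 2`. -/
def ValidNode2 (k : ℕ) : Node2 → Prop
  | none => True
  | some (_, s) => s.length + 2 ≤ k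

/-- A type-2 labeling of `X`, given by its label function `x` (the inverse of `ψ`). -/
def IsLabeling2 (k : ℕ) (X : Set Pt) (x : Node2 → Pt) : Prop :=
  Set.InjOn x {u | ValidNode2 k u} ∧ x '' {u | ValidNode2 k u} = X

/-- The `i`-th node (left-to-right) of the `(j+2)`-level of `T₂(k)`. -/
def node2At (j i : ℕ) : Node2 :=
  some (⟨i / 2 ^ j % 3, by omega⟩, strOfNat j (i % 2 ^ j))

/-- A type-2 labeling is nested. -/
def Nested2 (k : ℕ) (X : Set Pt) (x : Node2 → Pt) : Prop :=
  CCWEnum (layer X k 1) (fun _ : Fin 1 => x none) ∧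
  ∀ j : ℕ, j + 2 ≤ k →
    CCWEnum (layer X k (j + 2)) fun i : Fin (3 * 2 ^ j) => x (node2At j i.val)

/-- A type-2 labeling is adoptable. -/
def Adoptable2 (k : ℕ) (X : Set Pt) (x : Node2 → Pt) : Prop :=
  ∀ (c : Fin 3) (s : List Bool), s.length + 3 ≤ k →
    AdoptablePair (layer X k (s.length + 3)) (x (some (c, s)))
      (x (some (c, s ++ [false]))) (x (some (c, s ++ [true])))

/-- `previous[R_k(u)]` for a type-2 labeling, `u = (c, s)`. -/
def prev2 (k : ℕ) (x : Node2 → Pt) (c : Fin 3) (s : List Bool) : Pt :=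
  x (node2At (k - 2)
      ((c.val * 2 ^ (k - 2) + natOfStr (firstStr (k - 2) s) + (3 * 2 ^ (k - 2) - 1)) %
        (3 * 2 ^ (k - 2))))

/-- `next[R_k(u)]` for a type-2 labeling, `u = (c, s)`. -/
def next2 (k : ℕ) (x : Node2 → Pt) (c : Fin 3) (s : List Bool) : Pt :=
  x (node2At (k - 2)
      ((c.val * 2 ^ (k - 2) + natOfStr (lastStr (k - 2) s) + 1) % (3 * 2 ^ (k - 2))))

/-- A type-2 labeling is well laid (the root is the only node with `R_k(u) = R_k`). -/
def WellLaid2 (k : ℕ) (x : Node2 → Pt) : Prop :=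
  ∀ (c : Fin 3) (s : List Bool), s.length + 2 ≤ k →
    x (some (c, s)) ∈ convexHull ℝ
      ({prev2 k x c s, x (some (c, firstStr (k - 2) s)),
        x (some (c, lastStr (k - 2) s))} : Set Pt) ∧
    x (some (c, s)) ∈ convexHull ℝ
      ({x (some (c, firstStr (k - 2) s)), x (some (c, lastStr (k - 2) s)),
        next2 k x c s} : Set Pt)

/-- `X_u` for a type-2 labeling and a non-root node `u = (c, s)`. -/
def descSet2 (k : ℕ) (x : Node2 → Pt) (c : Fin 3) (s : List Bool) : Set Pt :=
  x '' {u | ∃ t : List Bool, u = some (c, t) ∧ t.length + 2 ≤ k ∧ s <+: t ∧ s ≠ t}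

/-- `X̄_u = X_u ∪ {x_u}` for a type-2 labeling and a non-root node `u = (c, s)`. -/
def barSet2 (k : ℕ) (x : Node2 → Pt) (c : Fin 3) (s : List Bool) : Set Pt :=
  insert (x (some (c, s))) (descSet2 k x c s)

/-- A type-2 labeling is an internal separation. -/
def InternalSep2 (k : ℕ) (X : Set Pt) (x : Node2 → Pt) : Prop :=
  (∀ (c : Fin 3) (s : List Bool), s.length + 3 ≤ k →
    ∀ y ∈ X \ descSet2 k x c s,
      ∀ a ∈ barSet2 k x c (s ++ [false]), ∀ b ∈ barSet2 k x c (s ++ [true]),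
        0 < orient a b y) ∧
  (∀ i : Fin 3,
    ∀ y ∈ X \ (barSet2 k x i [] ∪ barSet2 k x (i + 1) []),
      ∀ a ∈ barSet2 k x i [], ∀ b ∈ barSet2 k x (i + 1) [],
        0 < orient a b y)

/-- A type-2 labeling is an external separation. -/
def ExternalSep2 (k : ℕ) (X : Set Pt) (x : Node2 → Pt) : Prop :=
  ∀ (c : Fin 3) (s : List Bool), s.length + 3 ≤ k →
    ∀ y ∈ X \ barSet2 k x c s,
      (∀ a ∈ barSet2 k x c (s ++ [false]), 0 < orient a (x (some (c, s))) y) ∧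
      (∀ b ∈ barSet2 k x c (s ++ [true]), 0 < orient (x (some (c, s))) b y)

/-- One corner-refinement step: from `α_s = (q, o, p)` to `α_{s0}` (for `b = false`)
or `α_{s1}` (for `b = true`). -/
def cornerStep (α : Pt × Pt × Pt) (b : Bool) : Pt × Pt × Pt :=
  let q := α.1
  let o := α.2.1
  let p := α.2.2
  if b then (o + (1 / 5 : ℝ) • (q - o), o + (1 / 5 : ℝ) • (p - o), o + (2 / 5 : ℝ) • (p - o))
  else (o + (2 / 5 : ℝ) • (q - o), o + (1 / 5 : ℝ) • (q - o), o + (1 / 5 : ℝ) • (p - o))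

/-- The corner `α_s = (q_s, o_s, p_s)` assigned to the binary string `s` (with parameter `k`). -/
def corner (k : ℕ) (s : List Bool) : Pt × Pt × Pt :=
  s.foldl cornerStep
    (((0 : ℝ), (2 * 5 ^ (k + 1) : ℝ)), ((0 : ℝ), (0 : ℝ)), ((2 * 5 ^ (k + 1) : ℝ), (0 : ℝ)))

/-- The point `y_v` for a binary string `v = s ++ [b]` of positive length. -/
def ypt (k : ℕ) (v : List Bool) : Pt :=
  let α := corner k v.dropLast
  if v.getLastD false then α.2.1 + (1 / 5 : ℝ) • (α.2.2 - α.2.1)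
  else α.2.1 + (1 / 5 : ℝ) • (α.1 - α.2.1)

/-- The point `x_s`: the midpoint of `y_{s·0^(k+1−|s|)}` and `y_{s·1^(k+1−|s|)}`. -/
def xpt (k : ℕ) (s : List Bool) : Pt :=
  (1 / 2 : ℝ) •
    (ypt k (s ++ List.replicate (k + 1 - s.length) false) +
      ypt k (s ++ List.replicate (k + 1 - s.length) true))

/-- `p` is strictly inside the counterclockwise triangle `a b c`. -/
def InTri (a b c p : Pt) : Prop := 0 < orient a b p ∧ 0 < orient b c p ∧ 0 < orient c a p

theorem orient_rot (a b c : Pt) : orient a b c = orient b c a := by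
  unfold orient; ring

theorem orient_swap (a b c : Pt) : orient a b c = - orient b a c := by
  unfold orient; ring

theorem orient_bary (a b c p s t : Pt) :
    orient a b c * orient s t p =
      orient b c p * orient s t a + orient c a p * orient s t b + orient a b p * orient s t c := by
  unfold orient; ring

theorem orient_sum (a b c p : Pt) :
    orient a b c = orient b c p + orient c a p + orient a b p := by
  unfold orient; ring

theorem orient_left (a b : Pt) : orient a b a = 0 := by unfold orient; ring

theorem orient_right (a b : Pt) : orient a b b = 0 := by unfold orient; ring

/-- A linear functional that is nonnegative on the corners, and positive on one of them, is positive
strictly inside. -/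
theorem InTri.pos {a b c p : Pt} (h : InTri a b c p) (s t : Pt) (ha : 0 ≤ orient s t a)
    (hb : 0 ≤ orient s t b) (hc : 0 ≤ orient s t c)
    (hpos : 0 < orient s t a + orient s t b + orient s t c) : 0 < orient s t p := by
  obtain ⟨h1, h2, h3⟩ := h
  have hs := orient_sum a b c p
  have hb' := orient_bary a b c p s t
  have hD : 0 < orient a b c := by linarith
  have h4 : 0 < orient b c p * orient s t a + orient c a p * orient s t b
      + orient a b p * orient s t c := by
    have e1 := mul_nonneg h2.le ha
    have e2 := mul_nonneg h3.le hb
    have e3 := mul_nonneg h1.le hc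
    by_contra hcon
    have z1 : orient b c p * orient s t a = 0 := by linarith
    have z2 : orient c a p * orient s t b = 0 := by linarith
    have z3 : orient a b p * orient s t c = 0 := by linarith
    have y1 := (mul_eq_zero.1 z1).resolve_left h2.ne'
    have y2 := (mul_eq_zero.1 z2).resolve_left h3.ne'
    have y3 := (mul_eq_zero.1 z3).resolve_left h1.ne'
    linarith
  rw [← hb'] at h4
  exact (mul_pos_iff_of_pos_left hD).1 h4

/-- The combinatorial data used in the proof: `y h i` is the `i`-th point of height `h`. -/
structure Sys (H : ℕ) (N : ℤ) (Y : Set Pt) (y : ℕ → ℤ → Pt) : Prop where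
  hN : 2 * 2 ^ H ≤ N
  ccw : ∀ a b c : ℤ, a < b → b < c → c < a + N → 0 < orient (y 0 a) (y 0 b) (y 0 c)
  edge : ∀ p ∈ Y, ∀ a : ℤ, 0 < orient (y 0 a) (y 0 (a + 1)) p
  gp : ∀ p ∈ Y, ∀ a b : ℤ, a < b → b < a + N → orient (y 0 a) (y 0 b) p ≠ 0
  mem : ∀ (h : ℕ) (i : ℤ), 1 ≤ h → h ≤ H → y h i ∈ Y
  disj : ∀ (h h' : ℕ) (i i' : ℤ), h < h' → h' ≤ H → y h i ≠ y h' i'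
  sib : ∀ (h : ℕ) (i : ℤ), h < H → y h (2 * i) ≠ y h (2 * i + 1)
  adoptL : ∀ (h : ℕ) (i : ℤ), h < H →
    InTri (y h (2 * i - 1)) (y h (2 * i)) (y h (2 * i + 1)) (y (h + 1) i)
  adoptR : ∀ (h : ℕ) (i : ℤ), h < H →
    InTri (y h (2 * i)) (y h (2 * i + 1)) (y h (2 * i + 2)) (y (h + 1) i)
  uniq : ∀ a b c : ℤ, a < b → b < c → c < a + N → ∀ p ∈ Y, ∀ p' ∈ Y,
    InTri (y 0 a) (y 0 b) (y 0 c) p → InTri (y 0 a) (y 0 b) (y 0 c) p' → p = p'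

/-- Left half of being well laid, height `h`. -/
def WL (y : ℕ → ℤ → Pt) (h : ℕ) : Prop := ∀ i : ℤ,
  InTri (y 0 (i * 2 ^ h - 1)) (y 0 (i * 2 ^ h)) (y 0 (i * 2 ^ h + 2 ^ h - 1)) (y h i)

/-- Right half of being well laid, height `h`. -/
def WR (y : ℕ → ℤ → Pt) (h : ℕ) : Prop := ∀ i : ℤ,
  InTri (y 0 (i * 2 ^ h)) (y 0 (i * 2 ^ h + 2 ^ h - 1)) (y 0 (i * 2 ^ h + 2 ^ h)) (y h i)

/-- The only points cut off by the chord of a node are points of smaller height. -/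
def DD (Y : Set Pt) (y : ℕ → ℤ → Pt) (h : ℕ) : Prop := ∀ i : ℤ, ∀ p ∈ Y,
  orient (y 0 (i * 2 ^ h)) (y 0 (i * 2 ^ h + 2 ^ h - 1)) p < 0 →
    ∃ (h' : ℕ) (i' : ℤ), h' < h ∧ p = y h' i'

theorem Sys.two_pow_le {H : ℕ} {N : ℤ} {Y : Set Pt} {y : ℕ → ℤ → Pt} (S : Sys H N Y y)
    {h : ℕ} (hh : h + 1 ≤ H) : 4 * (2 : ℤ) ^ h ≤ N := by
  have h1 : (2 : ℤ) ^ (h + 1) ≤ 2 ^ H := pow_le_pow_right₀ (by norm_num) hh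
  have h2 := S.hN
  rw [pow_succ] at h1
  linarith

theorem DD_one {H : ℕ} {N : ℤ} {Y : Set Pt} {y : ℕ → ℤ → Pt} (S : Sys H N Y y) : DD Y y 1 := by
  intro i p hp h
  have := S.edge p hp (i * 2 ^ 1)
  rw [show i * 2 ^ 1 + 2 ^ 1 - 1 = i * 2 ^ 1 + 1 by ring] at h
  linarith

theorem DD_succ {H : ℕ} {N : ℤ} {Y : Set Pt} {y : ℕ → ℤ → Pt} (S : Sys H N Y y) {h : ℕ}
    (h1 : 1 ≤ h) (hh : h + 1 ≤ H) (wl : WL y h) (wr : WR y h) (dd : DD Y y h) :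
    DD Y y (h + 1) := by
  intro i p hp hneg
  have hN := S.two_pow_le hh
  have hm : (2 : ℤ) ≤ 2 ^ h := by
    calc (2 : ℤ) = 2 ^ 1 := by norm_num
      _ ≤ 2 ^ h := pow_le_pow_right₀ (by norm_num) h1
  have d0 := dd (2 * i) p hp
  have d1 := dd (2 * i + 1) p hp
  have r0 := wr (2 * i)
  have l1 := wl (2 * i + 1)
  have mem0 := S.mem h (2 * i) h1 (by omega)
  have mem1 := S.mem h (2 * i + 1) h1 (by omega)
  have hsib := S.sib h i (by omega)
  rw [show i * 2 ^ (h + 1) = 2 * i * 2 ^ h by ring, show (2 : ℤ) ^ (h + 1) = 2 * 2 ^ h by ring]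
    at hneg
  rw [show (2 * i + 1) * 2 ^ h = 2 * i * 2 ^ h + 2 ^ h by ring] at d1 l1
  generalize (2 : ℤ) ^ h = m at *
  generalize 2 * i * m = c at *
  set x0 := y h (2 * i)
  set x1 := y h (2 * i + 1)
  rw [show c + m + m - 1 = c + 2 * m - 1 by ring] at d1 l1
  by_cases q0 : orient (y 0 c) (y 0 (c + m - 1)) p < 0
  · obtain ⟨h', i', a, b⟩ := d0 q0
    exact ⟨h', i', by omega, b⟩
  by_cases q1 : orient (y 0 (c + m)) (y 0 (c + 2 * m - 1)) p < 0
  · obtain ⟨h', i', a, b⟩ := d1 q1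
    exact ⟨h', i', by omega, b⟩
  have g0 := S.gp p hp c (c + m - 1) (by omega) (by omega)
  have g1 := S.gp p hp (c + m) (c + 2 * m - 1) (by omega) (by omega)
  replace q0 : 0 < orient (y 0 c) (y 0 (c + m - 1)) p := lt_of_le_of_ne (not_lt.1 q0) g0.symm
  replace q1 : 0 < orient (y 0 (c + m)) (y 0 (c + 2 * m - 1)) p :=
    lt_of_le_of_ne (not_lt.1 q1) g1.symm
  have ed : ∀ p ∈ Y, 0 < orient (y 0 (c + m - 1)) (y 0 (c + m)) p := by
    intro p hp
    have := S.edge p hp (c + m - 1)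
    rwa [show c + m - 1 + 1 = c + m by ring] at this
  have cef := S.ccw c (c + m - 1) (c + m) (by omega) (by omega) (by omega)
  have ced := S.ccw c (c + m - 1) (c + 2 * m - 1) (by omega) (by omega) (by omega)
  have cfd := S.ccw c (c + m) (c + 2 * m - 1) (by omega) (by omega) (by omega)
  have gA := And.intro (S.gp p hp c (c + m) (by omega) (by omega))
    (S.gp x1 mem1 c (c + m) (by omega) (by omega))
  have U1 := S.uniq c (c + m - 1) (c + m) (by omega) (by omega) (by omega)
  have U2 := S.uniq c (c + m) (c + 2 * m - 1) (by omega) (by omega) (by omega)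
  generalize y 0 c = C at *
  generalize y 0 (c + 2 * m - 1) = D at *
  generalize y 0 (c + m - 1) = E at *
  generalize y 0 (c + m) = F at *
  by_cases qp : orient C F p < 0
  · refine ⟨h, 2 * i, by omega, ?_⟩
    refine U1 p hp x0 mem0 ⟨q0, ed p hp, ?_⟩ r0
    rw [orient_swap]; linarith
  · have qp' : 0 < orient C F p := lt_of_le_of_ne (not_lt.1 qp) gA.1.symm
    have x1in : 0 < orient C F x1 := by
      by_contra hcon
      have hlt : orient C F x1 < 0 := lt_of_le_of_ne (not_lt.1 hcon) gA.2
      refine hsib (U1 x0 mem0 x1 mem1 r0 ⟨?_, ed x1 mem1, ?_⟩)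
      · refine l1.pos C E ?_ cef.le ced.le ?_
        · rw [orient_right]
        · rw [orient_right]; linarith
      · rw [orient_swap]; linarith
    refine ⟨h, 2 * i + 1, by omega, ?_⟩
    refine U2 p hp x1 mem1 ⟨qp', q1, ?_⟩ ⟨x1in, l1.2.1, ?_⟩
    · rw [orient_swap]; linarith
    · refine l1.pos D C ?_ ?_ ?_ ?_
      · rw [orient_rot]; exact ced.le
      · rw [orient_rot]; exact cfd.le
      · rw [orient_left]
      · rw [orient_left, orient_rot D C, orient_rot D C]; linarith

theorem WL_succ {H : ℕ} {N : ℤ} {Y : Set Pt} {y : ℕ → ℤ → Pt} (S : Sys H N Y y) {h : ℕ}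
    (h1 : 1 ≤ h) (hh : h + 1 ≤ H) (wl : WL y h) (wr : WR y h) (dd : DD Y y h)
    (dd' : DD Y y (h + 1)) : WL y (h + 1) := by
  intro i
  have hN := S.two_pow_le hh
  have hm : (2 : ℤ) ≤ 2 ^ h := by
    calc (2 : ℤ) = 2 ^ 1 := by norm_num
      _ ≤ 2 ^ h := pow_le_pow_right₀ (by norm_num) h1
  have hp := S.mem (h + 1) i (by omega) hh
  have rv := wr (2 * i - 1)
  have r0 := wr (2 * i)
  have l1 := wl (2 * i + 1)
  have memv := S.mem h (2 * i - 1) h1 (by omega)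
  have had := S.adoptL h i (by omega)
  have hne := S.disj h (h + 1) (2 * i - 1) i (by omega) hh
  have dv : ¬ orient _ _ _ < 0 := fun hlt => by
    obtain ⟨h', i', a, b⟩ := dd (2 * i - 1) _ hp hlt
    exact S.disj h' (h + 1) i' i (by omega) hh b.symm
  have du : ¬ orient _ _ _ < 0 := fun hlt => by
    obtain ⟨h', i', a, b⟩ := dd' i _ hp hlt
    exact S.disj h' (h + 1) i' i (by omega) hh b.symm
  rw [show i * 2 ^ (h + 1) = 2 * i * 2 ^ h by ring, show (2 : ℤ) ^ (h + 1) = 2 * 2 ^ h by ring]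
    at *
  rw [show (2 * i + 1) * 2 ^ h = 2 * i * 2 ^ h + 2 ^ h by ring] at l1
  rw [show (2 * i - 1) * 2 ^ h = 2 * i * 2 ^ h - 2 ^ h by ring] at dv rv
  generalize (2 : ℤ) ^ h = m at *
  generalize 2 * i * m = c at *
  generalize y h (2 * i) = x0 at *
  generalize y h (2 * i + 1) = x1 at *
  generalize y h (2 * i - 1) = v at *
  generalize y (h + 1) i = x at *
  rw [show c + m + m - 1 = c + 2 * m - 1 by ring] at l1
  rw [show c - m + m = c by ring] at dv rv
  -- the corners: a = c - m, b = c - 1, c, e = c + m - 1, f = c + m, d = c + 2 m - 1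
  have gab := S.gp x hp (c - m) (c - 1) (by omega) (by omega)
  have gcd := S.gp x hp c (c + 2 * m - 1) (by omega) (by omega)
  have gbd := S.gp x hp (c - 1) (c + 2 * m - 1) (by omega) (by omega)
  have ed := S.edge x hp (c - 1)
  rw [show c - 1 + 1 = c by ring] at ed
  have bcd := S.ccw (c - 1) c (c + 2 * m - 1) (by omega) (by omega) (by omega)
  have bed := S.ccw (c - 1) (c + m - 1) (c + 2 * m - 1) (by omega) (by omega) (by omega)
  have bfd := S.ccw (c - 1) (c + m) (c + 2 * m - 1) (by omega) (by omega) (by omega)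
  have abd := S.ccw (c - m) (c - 1) (c + 2 * m - 1) (by omega) (by omega) (by omega)
  have acd := S.ccw (c - m) c (c + 2 * m - 1) (by omega) (by omega) (by omega)
  have aed := S.ccw (c - m) (c + m - 1) (c + 2 * m - 1) (by omega) (by omega) (by omega)
  have afd := S.ccw (c - m) (c + m) (c + 2 * m - 1) (by omega) (by omega) (by omega)
  have U := S.uniq (c - m) (c - 1) (c + 2 * m - 1) (by omega) (by omega) (by omega)
  generalize y 0 (c - m) = A at *
  generalize y 0 (c - 1) = B at *
  generalize y 0 (c + m - 1) = E at *
  generalize y 0 (c + m) = F at *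
  generalize y 0 (c + 2 * m - 1) = D at *
  generalize y 0 c = C at *
  replace dv : 0 < orient A B x := lt_of_le_of_ne (not_lt.1 dv) gab.symm
  replace du : 0 < orient C D x := lt_of_le_of_ne (not_lt.1 du) gcd.symm
  refine ⟨ed, du, ?_⟩
  by_contra hcon
  have hcon : 0 < orient B D x := by
    rw [orient_swap] at hcon
    exact lt_of_le_of_ne (by linarith) gbd.symm
  have L0 : 0 < orient D B x0 := by
    refine r0.pos D B ?_ ?_ ?_ ?_ <;> simp only [orient_rot D B] <;> linarith
  have L1 : 0 < orient D B x1 := by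
    refine l1.pos D B ?_ ?_ ?_ ?_ <;> simp only [orient_left, orient_rot D B] <;>
      linarith [orient_left B D, orient_rot B D D, orient_right B D]
  have Lv : 0 < orient B D v := by
    by_contra hv
    have : 0 < orient D B x := had.pos D B (by rw [orient_swap]; linarith) L0.le L1.le (by
      have := orient_swap D B v
      linarith)
    rw [orient_swap] at this
    linarith
  have M0 : 0 < orient D A x0 := by
    refine r0.pos D A ?_ ?_ ?_ ?_ <;> simp only [orient_rot D A] <;> linarith
  have M1 : 0 < orient D A x1 := by
    have := orient_left D A
    refine l1.pos D A ?_ ?_ ?_ ?_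
    · rw [orient_rot]; linarith
    · rw [orient_rot]; linarith
    · linarith
    · rw [orient_rot D A E, orient_rot D A F]; linarith
  have Mv : 0 < orient D A v := by
    have := orient_right D A
    refine rv.pos D A ?_ ?_ ?_ ?_
    · linarith
    · rw [orient_rot]; linarith
    · rw [orient_rot]; linarith
    · rw [orient_rot D A B, orient_rot D A C]; linarith
  have Mx : 0 < orient D A x := had.pos D A Mv.le M0.le M1.le (by linarith)
  exact hne (U v memv x hp ⟨rv.1, Lv, Mv⟩ ⟨dv, hcon, Mx⟩)

/-- Reflection in the vertical axis. -/
def rflx (p : Pt) : Pt := (-p.1, p.2)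

theorem orient_rflx (a b c : Pt) : orient (rflx a) (rflx b) (rflx c) = orient b a c := by
  unfold orient rflx; ring

theorem rflx_rflx (a : Pt) : rflx (rflx a) = a := by simp [rflx]

theorem rflx_inj {a b : Pt} (h : rflx a = rflx b) : a = b := by
  rw [← rflx_rflx a, h, rflx_rflx]

theorem InTri_rflx (a b c p : Pt) : InTri (rflx a) (rflx b) (rflx c) (rflx p) ↔ InTri c b a p := by
  unfold InTri
  simp only [orient_rflx]
  tauto

/-- The mirrored system. -/
def mir (y : ℕ → ℤ → Pt) (h : ℕ) (i : ℤ) : Pt := rflx (y h (-1 - i))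

theorem Sys.mirror {H : ℕ} {N : ℤ} {Y : Set Pt} {y : ℕ → ℤ → Pt} (S : Sys H N Y y) :
    Sys H N (rflx ⁻¹' Y) (mir y) where
  hN := S.hN
  ccw := by
    intro a b c hab hbc hca
    unfold mir
    rw [orient_rflx]
    have := S.ccw (-1 - c) (-1 - b) (-1 - a) (by omega) (by omega) (by omega)
    rwa [orient_rot] at this
  edge := by
    intro p hp a
    have := S.edge _ hp (-1 - (a + 1))
    rw [← rflx_rflx p]
    unfold mir
    rw [orient_rflx]
    rwa [show -1 - (a + 1) + 1 = -1 - a by ring] at this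
  gp := by
    intro p hp a b hab hba
    rw [← rflx_rflx p]
    unfold mir
    rw [orient_rflx]
    exact S.gp _ hp _ _ (by omega) (by omega)
  mem := by
    intro h i h1 h2
    simp only [mir, Set.mem_preimage, rflx_rflx]
    exact S.mem h _ h1 h2
  disj := by
    intro h h' i i' h1 h2 h3
    exact S.disj h h' _ _ h1 h2 (rflx_inj h3)
  sib := by
    intro h i h1 h2
    have := S.sib h (-1 - i) h1
    have h3 := rflx_inj h2
    rw [show -1 - 2 * i = 2 * (-1 - i) + 1 by ring,
      show -1 - (2 * i + 1) = 2 * (-1 - i) by ring] at h3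
    exact this h3.symm
  adoptL := by
    intro h i h1
    unfold mir
    rw [InTri_rflx]
    have := S.adoptR h (-1 - i) h1
    rwa [show 2 * (-1 - i) = -1 - (2 * i + 1) by ring,
      show -1 - (2 * i + 1) + 1 = -1 - 2 * i by ring,
      show -1 - (2 * i + 1) + 2 = -1 - (2 * i - 1) by ring] at this
  adoptR := by
    intro h i h1
    unfold mir
    rw [InTri_rflx]
    have := S.adoptL h (-1 - i) h1
    rwa [show 2 * (-1 - i) = -1 - (2 * i + 1) by ring,
      show -1 - (2 * i + 1) + 1 = -1 - 2 * i by ring,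
      show -1 - (2 * i + 1) - 1 = -1 - (2 * i + 2) by ring] at this
  uniq := by
    intro a b c hab hbc hca p hp p' hp' h1 h2
    rw [← rflx_rflx p] at h1
    rw [← rflx_rflx p'] at h2
    unfold mir at h1 h2
    rw [InTri_rflx] at h1 h2
    exact rflx_inj (S.uniq _ _ _ (by omega) (by omega) (by omega) _ hp _ hp' h1 h2)

theorem mir_mir (y : ℕ → ℤ → Pt) : mir (mir y) = y := by
  funext h i
  simp [mir, rflx_rflx]

theorem WL_mir {y : ℕ → ℤ → Pt} {h : ℕ} (w : WR y h) : WL (mir y) h := by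
  intro i
  unfold mir
  rw [InTri_rflx]
  have := w (-1 - i)
  rwa [show (-1 - i) * 2 ^ h = -1 - (i * 2 ^ h + 2 ^ h - 1) by ring,
    show -1 - (i * 2 ^ h + 2 ^ h - 1) + 2 ^ h - 1 = -1 - i * 2 ^ h by ring,
    show -1 - (i * 2 ^ h + 2 ^ h - 1) + 2 ^ h = -1 - (i * 2 ^ h - 1) by ring] at this

theorem WR_mir {y : ℕ → ℤ → Pt} {h : ℕ} (w : WL y h) : WR (mir y) h := by
  intro i
  unfold mir
  rw [InTri_rflx]
  have := w (-1 - i)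
  rwa [show (-1 - i) * 2 ^ h = -1 - (i * 2 ^ h + 2 ^ h - 1) by ring,
    show -1 - (i * 2 ^ h + 2 ^ h - 1) + 2 ^ h - 1 = -1 - i * 2 ^ h by ring,
    show -1 - (i * 2 ^ h + 2 ^ h - 1) - 1 = -1 - (i * 2 ^ h + 2 ^ h) by ring] at this

theorem DD_mir {Y : Set Pt} {y : ℕ → ℤ → Pt} {h : ℕ} (w : DD Y y h) :
    DD (rflx ⁻¹' Y) (mir y) h := by
  intro i p hp hneg
  rw [← rflx_rflx p] at hneg
  unfold mir at hneg
  rw [orient_rflx] at hneg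
  have := w (-1 - i) _ hp
  rw [show (-1 - i) * 2 ^ h = -1 - (i * 2 ^ h + 2 ^ h - 1) by ring,
    show -1 - (i * 2 ^ h + 2 ^ h - 1) + 2 ^ h - 1 = -1 - i * 2 ^ h by ring] at this
  obtain ⟨h', i', a, b⟩ := this hneg
  refine ⟨h', -1 - i', a, ?_⟩
  simp [mir, ← b, rflx_rflx]

theorem core {H : ℕ} {N : ℤ} {Y : Set Pt} {y : ℕ → ℤ → Pt} (S : Sys H N Y y) (h : ℕ)
    (h1 : 1 ≤ h) (hh : h ≤ H) : WL y h ∧ WR y h ∧ DD Y y h := by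
  induction h, h1 using Nat.le_induction with
  | base =>
    refine ⟨?_, ?_, DD_one S⟩
    · intro i
      have := S.adoptL 0 i (by omega)
      rwa [mul_comm 2 i, show i * 2 + 1 = i * 2 + 2 - 1 by ring] at this
    · intro i
      have := S.adoptR 0 i (by omega)
      rwa [mul_comm 2 i, show i * 2 + 1 = i * 2 + 2 - 1 by ring] at this
  | succ h h1 ih =>
    obtain ⟨wl, wr, dd⟩ := ih (by omega)
    have dd' := DD_succ S h1 hh wl wr dd
    refine ⟨WL_succ S h1 hh wl wr dd dd', ?_, dd'⟩
    have := WL_succ S.mirror h1 hh (WL_mir wr) (WR_mir wl) (DD_mir dd) (DD_mir dd')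
    have := WR_mir this
    rwa [mir_mir] at this

theorem InTri.mem_convexHull {a b c p : Pt} (h : InTri a b c p) :
    p ∈ convexHull ℝ ({a, b, c} : Set Pt) := by
  obtain ⟨h1, h2, h3⟩ := h
  have hs := orient_sum a b c p
  have hD : 0 < orient a b c := by linarith
  have key := (convex_convexHull ℝ ({a, b, c} : Set Pt)).sum_mem (t := Finset.univ)
    (w := ![orient b c p / orient a b c, orient c a p / orient a b c, orient a b p / orient a b c])
    (z := ![a, b, c]) (by
      intro i _
      fin_cases i <;> simp <;> positivity) (by
      simp only [Fin.sum_univ_three, Matrix.cons_val_zero, Matrix.cons_val_one, Matrix.cons_val]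
      field_simp
      linarith) (by
      intro i _
      apply subset_convexHull
      fin_cases i <;> simp)
  convert key using 1
  simp only [Fin.sum_univ_three, Matrix.cons_val_zero, Matrix.cons_val_one, Matrix.cons_val]
  ext
  · simp only [Prod.fst_add, Prod.smul_fst, smul_eq_mul]
    field_simp
    unfold orient; ring
  · simp only [Prod.snd_add, Prod.smul_snd, smul_eq_mul]
    field_simp
    unfold orient; ring

theorem convex_half (s t : Pt) : Convex ℝ {p : Pt | 0 ≤ orient s t p} := by
  intro p hp q hq u v hu hv huv
  simp only [Set.mem_ofPred_eq] at *
  have : orient s t (u • p + v • q) = u * orient s t p + v * orient s t q := by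
    have hv' : v = 1 - u := by linarith
    subst hv'
    simp only [orient, Prod.fst_add, Prod.snd_add, Prod.smul_fst, Prod.smul_snd, smul_eq_mul]
    ring
  rw [this]
  positivity

theorem continuous_orient (s t : Pt) : Continuous fun p : Pt => orient s t p := by
  unfold orient; fun_prop

theorem interior_half {s t p : Pt} (hst : s ≠ t) {A : Set Pt} (hA : A ⊆ {p | 0 ≤ orient s t p})
    (hp : p ∈ interior A) : 0 < orient s t p := by
  have hc : Continuous fun r : ℝ => (p.1 + r * (t.2 - s.2), p.2 - r * (t.1 - s.1)) := by fun_prop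
  have h0 : (fun r : ℝ => ((p.1 + r * (t.2 - s.2), p.2 - r * (t.1 - s.1)) : Pt)) 0 = p := by
    simp
  have hopen : IsOpen ((fun r : ℝ => ((p.1 + r * (t.2 - s.2), p.2 - r * (t.1 - s.1)) : Pt)) ⁻¹'
      interior A) := isOpen_interior.preimage hc
  have hmem : (0 : ℝ) ∈ ((fun r : ℝ => ((p.1 + r * (t.2 - s.2), p.2 - r * (t.1 - s.1)) : Pt)) ⁻¹'
      interior A) := by
    simpa using hp
  obtain ⟨ε, hε, hb⟩ := Metric.isOpen_iff.1 hopen 0 hmem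
  have hin : (ε / 2) ∈ Metric.ball (0 : ℝ) ε := by
    simp [abs_of_pos hε]; linarith
  have h1 := hA (interior_subset (hb hin))
  simp only [Set.mem_ofPred_eq, orient] at h1
  unfold orient
  have h2 : 0 < (t.1 - s.1) ^ 2 + (t.2 - s.2) ^ 2 := by
    by_contra hcon
    apply hst
    have e1 : t.1 - s.1 = 0 := by nlinarith [sq_nonneg (t.1 - s.1), sq_nonneg (t.2 - s.2)]
    have e2 : t.2 - s.2 = 0 := by nlinarith [sq_nonneg (t.1 - s.1), sq_nonneg (t.2 - s.2)]
    ext <;> linarith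
  have h3 := mul_pos (half_pos hε) h2
  nlinarith

theorem ne_of_orient {a b c : Pt} (h : 0 < orient a b c) : a ≠ b ∧ b ≠ c ∧ c ≠ a := by
  refine ⟨?_, ?_, ?_⟩ <;> rintro rfl <;> simp [orient] at h
  all_goals nlinarith

theorem interior_tri {a b c p : Pt} (h : 0 < orient a b c) :
    p ∈ interior (convexHull ℝ ({a, b, c} : Set Pt)) ↔ InTri a b c p := by
  have hne := ne_of_orient h
  have hb : 0 < orient b c a := by rwa [← orient_rot]
  have hc : 0 < orient c a b := by rwa [orient_rot]
  have l := orient_left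
  have r := orient_right
  constructor
  · intro hp
    refine ⟨interior_half hne.1 (convexHull_min ?_ (convex_half _ _)) hp,
      interior_half hne.2.1 (convexHull_min ?_ (convex_half _ _)) hp,
      interior_half hne.2.2 (convexHull_min ?_ (convex_half _ _)) hp⟩
    all_goals
      rintro q (rfl | rfl | rfl) <;> simp only [Set.mem_ofPred_eq, l, r, le_refl] <;> linarith
  · intro hp
    have hopen : IsOpen {q | InTri a b c q} := by
      unfold InTri
      exact ((isOpen_lt continuous_const (continuous_orient a b))).inter
        (((isOpen_lt continuous_const (continuous_orient b c))).inter
        (isOpen_lt continuous_const (continuous_orient c a)))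
    exact interior_maximal (fun q hq => InTri.mem_convexHull hq) hopen hp

theorem emod_add_cases {n a d : ℤ} (hd : 0 ≤ d) (hdn : d < n) :
    (a % n + d < n ∧ (a + d) % n = a % n + d) ∨ (n ≤ a % n + d ∧ (a + d) % n = a % n + d - n) := by
  have hn : 0 < n := by omega
  have h1 := Int.emod_nonneg a hn.ne'
  have h2 := Int.emod_lt_of_pos a hn
  have h3 : (a + d) % n = (a % n + d) % n := by simp
  rw [h3]
  rcases lt_or_ge (a % n + d) n with h | h
  · exact Or.inl ⟨h, Int.emod_eq_of_lt (by omega) h⟩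
  · refine Or.inr ⟨h, ?_⟩
    rw [← Int.sub_emod_right, Int.emod_eq_of_lt (by omega) (by omega)]

theorem cyc_ccw {n : ℕ} {R : Set Pt} {q : ℕ → Pt} (hq : CCWEnum R (fun i : Fin n => q i))
    {a b c : ℤ} (hab : a < b) (hbc : b < c) (hca : c < a + n) :
    0 < orient (q (a % n).toNat) (q (b % n).toNat) (q (c % n).toNat) := by
  obtain ⟨-, -, h⟩ := hq
  have h' : ∀ a b c : ℕ, a < b → b < c → c < n → 0 < orient (q a) (q b) (q c) :=
    fun a b c h1 h2 h3 => h ⟨a, by omega⟩ ⟨b, by omega⟩ ⟨c, h3⟩ h1 h2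
  have hn : (0 : ℤ) < n := by omega
  have h1 := Int.emod_nonneg a hn.ne'
  have h2 := Int.emod_lt_of_pos a hn
  have hb := emod_add_cases (n := n) (a := a) (d := b - a) (by omega) (by omega)
  have hc := emod_add_cases (n := n) (a := a) (d := c - a) (by omega) (by omega)
  rw [show a + (b - a) = b by ring] at hb
  rw [show a + (c - a) = c by ring] at hc
  rcases hb with hb | hb <;> rcases hc with hc | hc
  · exact h' _ _ _ (by omega) (by omega) (by omega)
  · rw [orient_rot, orient_rot]
    exact h' _ _ _ (by omega) (by omega) (by omega)
  · omega
  · rw [orient_rot]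
    exact h' _ _ _ (by omega) (by omega) (by omega)

theorem cyc_ne {n : ℕ} {R : Set Pt} {q : ℕ → Pt} (hq : CCWEnum R (fun i : Fin n => q i))
    {a b : ℤ} (hab : a < b) (hba : b < a + n) :
    q (a % n).toNat ≠ q (b % n).toNat := by
  obtain ⟨h, -, -⟩ := hq
  intro heq
  have hn : (0 : ℤ) < n := by omega
  have h1 := Int.emod_nonneg a hn.ne'
  have h2 := Int.emod_lt_of_pos a hn
  have hb := emod_add_cases (n := n) (a := a) (d := b - a) (by omega) (by omega)
  rw [show a + (b - a) = b by ring] at hb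
  have := @h ⟨(a % n).toNat, by omega⟩ ⟨(b % n).toNat, by omega⟩ heq
  simp only [Fin.mk.injEq] at this
  omega

theorem cyc_mem {n : ℕ} {R : Set Pt} {q : ℕ → Pt} (hq : CCWEnum R (fun i : Fin n => q i))
    (hn : 0 < n) (a : ℤ) : q (a % n).toNat ∈ R := by
  rw [← hq.2.1]
  have h1 := Int.emod_nonneg a (b := n) (by omega)
  have h2 := Int.emod_lt_of_pos a (b := n) (by omega)
  exact ⟨⟨(a % n).toNat, by omega⟩, rfl⟩

theorem cyc_surj {n : ℕ} {R : Set Pt} {q : ℕ → Pt} (hq : CCWEnum R (fun i : Fin n => q i))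
    (hn : 0 < n) {p : Pt} (hp : p ∈ R) (a : ℤ) :
    ∃ b : ℤ, a ≤ b ∧ b < a + n ∧ p = q (b % n).toNat := by
  rw [← hq.2.1] at hp
  obtain ⟨⟨i, hi⟩, rfl⟩ := hp
  have h1 := Int.emod_nonneg ((i : ℤ) - a) (b := n) (by omega)
  have h2 := Int.emod_lt_of_pos ((i : ℤ) - a) (b := n) (by omega)
  refine ⟨a + ((i : ℤ) - a) % n, by omega, by omega, ?_⟩
  have : (a + ((i : ℤ) - a) % n) % n = i := by
    rw [Int.add_emod_emod, show a + ((i : ℤ) - a) = i by ring]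
    exact Int.emod_eq_of_lt (by omega) (by omega)
  simp [this]

theorem peel_iter_anti (X : Set Pt) {m n : ℕ} (h : m ≤ n) : peel^[n] X ⊆ peel^[m] X := by
  induction n, h using Nat.le_induction with
  | base => exact subset_rfl
  | succ n _ ih =>
    rw [Function.iterate_succ_apply']
    exact Set.sdiff_subset.trans ih

theorem extremePts_subset (X : Set Pt) : extremePts X ⊆ X := extremePoints_convexHull_subset

theorem hull_extremePts {X : Set Pt} (hX : X.Finite) :
    convexHull ℝ (extremePts X) = convexHull ℝ X := by
  have h1 := closure_convexHull_extremePoints (hX.isCompact_convexHull ℝ) (convex_convexHull ℝ X)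
  have hf : (extremePts X).Finite := hX.subset (extremePts_subset X)
  rw [← h1]
  exact ((hf.isCompact_convexHull ℝ).isClosed.closure_eq).symm

theorem layer_eq (X : Set Pt) {k h : ℕ} (hh : h ≤ k) :
    layer X k (k - h) = extremePts (peel^[h] X) := by
  unfold layer layerSub
  rw [show k - (k - h) = h by omega]

theorem bridge (X : Set Pt) (hX : IsNACS X) (k : ℕ) (hk : HasLayers X k) (M H : ℕ) (hM : 2 ≤ M)
    (hH : H + 1 ≤ k) (z : ℕ → ℕ → Pt)
    (hz : ∀ h ≤ H, CCWEnum (layer X k (k - h)) (fun i : Fin (M * 2 ^ (H - h)) => z h i))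
    (ha : ∀ h < H, ∀ i < M * 2 ^ (H - (h + 1)),
      AdoptablePair (layer X k (k - h)) (z (h + 1) i) (z h (2 * i)) (z h (2 * i + 1))) :
    Sys H (M * 2 ^ H : ℕ) (peel X)
      (fun h i => z h (i % ((M * 2 ^ (H - h) : ℕ) : ℤ)).toNat) := by
  obtain ⟨hfin, -, hgp, huniq⟩ := hX
  have hpos : ∀ h, 0 < M * 2 ^ (H - h) := fun h => by positivity
  have hmem : ∀ (h : ℕ) (i : ℤ), h ≤ H →
      z h (i % ((M * 2 ^ (H - h) : ℕ) : ℤ)).toNat ∈ extremePts (peel^[h] X) := by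
    intro h i hh
    have := cyc_mem (hz h hh) (hpos h) i
    rwa [layer_eq X (by omega)] at this
  have hz0 := hz 0 (Nat.zero_le _)
  have gp : ∀ p ∈ peel X, ∀ a b : ℤ, a < b → b < a + (M * 2 ^ H : ℕ) →
      orient (z 0 (a % ((M * 2 ^ (H - 0) : ℕ) : ℤ)).toNat)
        (z 0 (b % ((M * 2 ^ (H - 0) : ℕ) : ℤ)).toNat) p ≠ 0 := by
    intro p hp a b hab hba
    have ma := hmem 0 a (Nat.zero_le _)
    have mb := hmem 0 b (Nat.zero_le _)
    refine hgp _ (extremePts_subset _ ma) _ (extremePts_subset _ mb) p hp.1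
      (cyc_ne hz0 hab hba) ?_ ?_
    · intro h; exact hp.2 (h ▸ ma)
    · intro h; exact hp.2 (h ▸ mb)
  have hN : 2 * 2 ^ H ≤ M * 2 ^ H := Nat.mul_le_mul_right _ hM
  have hN1 : 1 ≤ 2 ^ H := Nat.one_le_two_pow
  have hdouble : ∀ h, h < H → M * 2 ^ (H - h) = 2 * (M * 2 ^ (H - (h + 1))) := by
    intro h hh
    rw [show H - h = (H - (h + 1)) + 1 by omega, pow_succ]; ring
  have hfour : ∀ h, h < H → 4 ≤ M * 2 ^ (H - h) := by
    intro h hh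
    rw [hdouble h hh]
    have : 1 ≤ 2 ^ (H - (h + 1)) := Nat.one_le_two_pow
    nlinarith
  have had : ∀ h, h < H → ∀ i : ℤ, AdoptablePair (layer X k (k - h))
      (z (h + 1) (i % ((M * 2 ^ (H - (h + 1)) : ℕ) : ℤ)).toNat)
      (z h ((2 * i) % ((M * 2 ^ (H - h) : ℕ) : ℤ)).toNat)
      (z h ((2 * i + 1) % ((M * 2 ^ (H - h) : ℕ) : ℤ)).toNat) := by
    intro h hh i
    have hp' := hpos (h + 1)
    have key := ha h hh
    rw [hdouble h hh]
    generalize M * 2 ^ (H - (h + 1)) = n at *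
    have h1 := Int.emod_nonneg i (b := n) (by omega)
    have h2 := Int.emod_lt_of_pos i (b := n) (by omega)
    have e1 : (2 * i) % ((2 * n : ℕ) : ℤ) = 2 * (i % n) := by
      push_cast
      exact Int.mul_emod_mul_of_pos _ _ (by norm_num)
    have e2 : (2 * i + 1) % ((2 * n : ℕ) : ℤ) = 2 * (i % n) + 1 := by
      rw [← Int.emod_add_emod, e1]
      exact Int.emod_eq_of_lt (by omega) (by push_cast; omega)
    rw [e1, e2]
    have := key (i % n).toNat (by omega)
    rwa [show (2 * (i % (n : ℤ)) + 1).toNat = 2 * (i % (n : ℤ)).toNat + 1 by omega,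
      show (2 * (i % (n : ℤ))).toNat = 2 * (i % (n : ℤ)).toNat by omega]
  refine ⟨?_, ?_, ?_, gp, ?_, ?_, ?_, ?_, ?_, ?_⟩
  · exact_mod_cast hN
  · intro a b c hab hbc hca
    exact cyc_ccw hz0 hab hbc hca
  · intro p hp a
    have g := gp p hp a (a + 1) (by omega) (by omega)
    refine lt_of_le_of_ne ?_ g.symm
    have hp' : p ∈ convexHull ℝ (extremePts X) := by
      rw [hull_extremePts hfin]; exact subset_convexHull ℝ X hp.1
    refine convexHull_min (t := {p : Pt | 0 ≤ orient _ _ p}) ?_ (convex_half _ _) hp'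
    intro q hq
    have hq' : q ∈ layer X k (k - 0) := by rw [layer_eq X (Nat.zero_le _)]; exact hq
    obtain ⟨b, h1, h2, rfl⟩ := cyc_surj hz0 (hpos 0) hq' a
    rcases eq_or_ne b a with rfl | hba
    · simp [orient_left]
    rcases eq_or_ne b (a + 1) with rfl | hba'
    · simp [orient_right]
    exact (cyc_ccw hz0 (a := a) (b := a + 1) (c := b) (by omega) (by omega) h2).le
  · intro h i h1 hh
    exact peel_iter_anti X h1 (extremePts_subset _ (hmem h i hh))
  · intro h h' i i' hlt hh heq
    have m1 := hmem h i (by omega)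
    have m2 := peel_iter_anti X (show h + 1 ≤ h' from hlt) (extremePts_subset _ (hmem h' i' hh))
    rw [Function.iterate_succ_apply'] at m2
    exact m2.2 (heq ▸ m1)
  · intro h i hh
    have := hfour h hh
    exact cyc_ne (hz h hh.le) (by omega) (by omega)
  · intro h i hh
    have h4 := hfour h hh
    have c := cyc_ccw (hz h hh.le) (a := 2 * i - 1) (b := 2 * i) (c := 2 * i + 1)
      (by omega) (by omega) (by omega)
    have hne := ne_of_orient c
    have m := cyc_mem (hz h hh.le) (hpos h) (2 * i - 1)
    rw [← interior_tri c]
    have := had h hh i _ ⟨m, by simp only [Set.mem_insert_iff, Set.mem_singleton_iff, not_or]; exact ⟨hne.1, hne.2.2.symm⟩⟩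
    convert this using 3
    ext w
    simp only [Set.mem_insert_iff, Set.mem_singleton_iff]
    tauto
  · intro h i hh
    have h4 := hfour h hh
    have c := cyc_ccw (hz h hh.le) (a := 2 * i) (b := 2 * i + 1) (c := 2 * i + 2)
      (by omega) (by omega) (by omega)
    have hne := ne_of_orient c
    have m := cyc_mem (hz h hh.le) (hpos h) (2 * i + 2)
    rw [← interior_tri c]
    exact had h hh i _ ⟨m, by simp only [Set.mem_insert_iff, Set.mem_singleton_iff, not_or]; exact ⟨hne.2.2, hne.2.1.symm⟩⟩
  · intro a b c hab hbc hca p hp p' hp' h1 h2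
    have cc := cyc_ccw hz0 hab hbc hca
    have hne := ne_of_orient cc
    have hl : ∀ i : ℤ, z 0 (i % ((M * 2 ^ (H - 0) : ℕ) : ℤ)).toNat ∈ layer X k k :=
      fun i => cyc_mem hz0 (hpos 0) i
    have U := huniq k hk k (by omega) le_rfl _ (hl a) _ (hl b) _ (hl c) hne.1 hne.2.2.symm hne.2.1
    have hsub : layerSub X k (k - 1) = peel X := by
      unfold layerSub
      rw [show k - (k - 1) = 1 by omega]; rfl
    rw [hsub] at U
    exact U.unique ⟨hp, (interior_tri cc).2 h1⟩ ⟨hp', (interior_tri cc).2 h2⟩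

theorem natOfStr_snoc (s : List Bool) (b : Bool) :
    natOfStr (s ++ [b]) = 2 * natOfStr s + b.toNat := by
  simp [natOfStr, List.foldl_append]

theorem strOfNat_length (j i : ℕ) : (strOfNat j i).length = j := by simp [strOfNat]

theorem strOfNat_snoc (j i : ℕ) (b : Bool) :
    strOfNat (j + 1) (2 * i + b.toNat) = strOfNat j i ++ [b] := by
  unfold strOfNat
  rw [List.range_succ, List.map_append]
  congr 1
  · apply List.map_congr_left
    intro t ht
    rw [List.mem_range] at ht
    rw [show j + 1 - 1 - t = (j - 1 - t) + 1 by omega, Nat.testBit_succ]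
    congr 1
    cases b <;> simp <;> omega
  · cases b <;> simp

theorem strOfNat_natOfStr (s : List Bool) : strOfNat s.length (natOfStr s) = s := by
  induction s using List.reverseRecOn with
  | nil => simp [strOfNat]
  | append_singleton s b ih =>
    rw [natOfStr_snoc, List.length_append, List.length_singleton, strOfNat_snoc, ih]

theorem natOfStr_lt (s : List Bool) : natOfStr s < 2 ^ s.length := by
  induction s using List.reverseRecOn with
  | nil => simp [natOfStr]
  | append_singleton s b ih =>
    rw [natOfStr_snoc, List.length_append, List.length_singleton, pow_succ]
    cases b <;> simp <;> omega

theorem natOfStr_false (s : List Bool) (m : ℕ) :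
    natOfStr (s ++ List.replicate m false) = natOfStr s * 2 ^ m := by
  induction m with
  | zero => simp
  | succ m ih =>
    rw [List.replicate_succ', ← List.append_assoc, natOfStr_snoc, ih, pow_succ]
    simp; ring

theorem natOfStr_true (s : List Bool) (m : ℕ) :
    natOfStr (s ++ List.replicate m true) + 1 = natOfStr s * 2 ^ m + 2 ^ m := by
  induction m with
  | zero => simp
  | succ m ih =>
    rw [List.replicate_succ', ← List.append_assoc, natOfStr_snoc, pow_succ]
    simp; linarith

theorem firstStr_length {k : ℕ} {s : List Bool} (h : s.length ≤ k) : (firstStr k s).length = k := by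
  simp [firstStr]; omega

theorem lastStr_length {k : ℕ} {s : List Bool} (h : s.length ≤ k) : (lastStr k s).length = k := by
  simp [lastStr]; omega

theorem toNat_natCast_emod (a n : ℕ) : ((a : ℤ) % (n : ℤ)).toNat = a % n := by
  rw [← Int.natCast_mod, Int.toNat_natCast]

theorem toNat_pred_emod (a n : ℕ) (hn : 0 < n) :
    (((a : ℤ) - 1) % (n : ℤ)).toNat = (a + (n - 1)) % n := by
  rw [← toNat_natCast_emod]
  congr 1
  rw [← Int.add_emod_right]
  congr 1
  omega

theorem wellLaid1 (X : Set Pt) (hX : IsNACS X) (k : ℕ) (hk : HasLayers X k)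
    (x : List Bool → Pt) (_hl : IsLabeling1 k X x) (hn : Nested1 k X x) (ha : Adoptable1 k X x) :
    WellLaid1 k x := by
  intro s hs1 hsk
  have e : ∀ h, h ≤ k - 1 → 2 * 2 ^ (k - 1 - h) = 2 ^ (k - h) := by
    intro h hh
    rw [show k - h = (k - 1 - h) + 1 by omega, pow_succ]; ring
  have S := bridge X hX k hk 2 (k - 1) le_rfl (by omega) (fun h i => x (strOfNat (k - h) i))
    (by
      intro h hh
      rw [e h hh]
      exact hn (k - h) (by omega) (by omega))
    (by
      intro h hh i _
      have := ha (strOfNat (k - (h + 1)) i) (by rw [strOfNat_length]; omega)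
        (by rw [strOfNat_length]; omega)
      rw [strOfNat_length, ← strOfNat_snoc, ← strOfNat_snoc,
        show k - (h + 1) + 1 = k - h by omega] at this
      exact this)
  rcases eq_or_lt_of_le hsk with hsk' | hsk'
  · have e1 : firstStr k s = s := by simp [firstStr, hsk']
    rw [e1]
    exact ⟨subset_convexHull ℝ _ (by simp), subset_convexHull ℝ _ (by simp)⟩
  obtain ⟨wl, wr, -⟩ := core S (k - s.length) (by omega) (by omega)
  have l := (wl (natOfStr s)).mem_convexHull
  have r := (wr (natOfStr s)).mem_convexHull
  have f1 := natOfStr_false s (k - s.length)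
  have f2 := natOfStr_true s (k - s.length)
  have g1 : ((natOfStr s : ℕ) : ℤ) * 2 ^ (k - s.length) = (natOfStr (firstStr k s) : ℤ) := by
    unfold firstStr; rw [f1]; push_cast; rfl
  have g2 : ((natOfStr s : ℕ) : ℤ) * 2 ^ (k - s.length) + 2 ^ (k - s.length)
      = ((natOfStr (lastStr k s) + 1 : ℕ) : ℤ) := by
    unfold lastStr; rw [f2]; push_cast; rfl
  have lf := natOfStr_lt (firstStr k s)
  have ll := natOfStr_lt (lastStr k s)
  have sf := strOfNat_natOfStr (firstStr k s)
  have sl := strOfNat_natOfStr (lastStr k s)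
  rw [firstStr_length hsk] at lf sf
  rw [lastStr_length hsk] at ll sl
  have ls := natOfStr_lt s
  have ss := strOfNat_natOfStr s
  have e0 := e 0 (by omega)
  simp only [Nat.sub_zero] at e0
  have eh := e (k - s.length) (by omega)
  rw [show k - (k - s.length) = s.length by omega] at eh
  rw [g2, g1] at l
  rw [g2, g1] at r
  rw [show ((natOfStr (lastStr k s) + 1 : ℕ) : ℤ) - 1 = (natOfStr (lastStr k s) : ℤ) by
    push_cast; ring] at l r
  simp only [e0, eh, toNat_natCast_emod, toNat_pred_emod _ _ (Nat.two_pow_pos _), Nat.sub_zero,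
    Nat.mod_eq_of_lt lf, Nat.mod_eq_of_lt ll, Nat.mod_eq_of_lt ls, sf, sl, ss,
    show k - (k - s.length) = s.length by omega] at l r
  exact ⟨l, r⟩

theorem node2At_snoc (j i : ℕ) (b : Bool) :
    node2At (j + 1) (2 * i + b.toNat) =
      some (⟨i / 2 ^ j % 3, by omega⟩, strOfNat j (i % 2 ^ j) ++ [b]) := by
  have hb : b.toNat < 2 := by cases b <;> simp
  have h1 : (2 * i + b.toNat) / 2 ^ (j + 1) = i / 2 ^ j := by
    rw [pow_succ', ← Nat.div_div_eq_div_mul]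
    congr 1
    omega
  have h2 : (2 * i + b.toNat) % 2 ^ (j + 1) = 2 * (i % 2 ^ j) + b.toNat := by
    rw [pow_succ', Nat.mod_mul]
    have e1 : (2 * i + b.toNat) / 2 = i := by omega
    rw [e1]
    omega
  unfold node2At
  simp only [h1, h2, strOfNat_snoc]

theorem node2At_eq (c : Fin 3) (s : List Bool) :
    node2At s.length (c.val * 2 ^ s.length + natOfStr s) = some (c, s) := by
  have ls := natOfStr_lt s
  have h1 : (c.val * 2 ^ s.length + natOfStr s) / 2 ^ s.length = c.val := by
    rw [mul_comm, Nat.mul_add_div (Nat.two_pow_pos _), Nat.div_eq_of_lt ls]; rfl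
  have h2 : (c.val * 2 ^ s.length + natOfStr s) % 2 ^ s.length = natOfStr s := by
    rw [mul_comm, Nat.mul_add_mod, Nat.mod_eq_of_lt ls]
  unfold node2At
  simp only [h1, h2, strOfNat_natOfStr, Nat.mod_eq_of_lt c.isLt]

theorem idx_lt (c : Fin 3) (s : List Bool) :
    c.val * 2 ^ s.length + natOfStr s < 3 * 2 ^ s.length := by
  have ls := natOfStr_lt s
  have := c.isLt
  nlinarith

theorem wellLaid2 (X : Set Pt) (hX : IsNACS X) (k : ℕ) (hk : HasLayers X k)
    (x : Node2 → Pt) (_hl : IsLabeling2 k X x) (hn : Nested2 k X x) (ha : Adoptable2 k X x) :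
    WellLaid2 k x := by
  intro c s hs
  have hsk : s.length ≤ k - 2 := by omega
  have S := bridge X hX k hk 3 (k - 2) (by norm_num) (by omega)
    (fun h i => x (node2At (k - 2 - h) i))
    (by
      intro h hh
      have := hn.2 (k - 2 - h) (by omega)
      rwa [show k - 2 - h + 2 = k - h by omega] at this)
    (by
      intro h hh i _
      have := ha ⟨i / 2 ^ (k - 2 - (h + 1)) % 3, by omega⟩
        (strOfNat (k - 2 - (h + 1)) (i % 2 ^ (k - 2 - (h + 1)))) (by rw [strOfNat_length]; omega)
      rw [strOfNat_length, ← node2At_snoc, ← node2At_snoc,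
        show k - 2 - (h + 1) + 1 = k - 2 - h by omega,
        show k - 2 - (h + 1) + 3 = k - h by omega] at this
      exact this)
  rcases eq_or_lt_of_le hsk with hsk' | hsk'
  · have e1 : firstStr (k - 2) s = s := by simp [firstStr, hsk']
    rw [e1]
    exact ⟨subset_convexHull ℝ _ (by simp), subset_convexHull ℝ _ (by simp)⟩
  obtain ⟨wl, wr, -⟩ := core S (k - 2 - s.length) (by omega) (by omega)
  have l := (wl (c.val * 2 ^ s.length + natOfStr s : ℕ)).mem_convexHull
  have r := (wr (c.val * 2 ^ s.length + natOfStr s : ℕ)).mem_convexHull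
  have f1 := natOfStr_false s (k - 2 - s.length)
  have f2 := natOfStr_true s (k - 2 - s.length)
  have hpow : 2 ^ s.length * 2 ^ (k - 2 - s.length) = 2 ^ (k - 2) := by
    rw [← pow_add]; congr 1; omega
  have g1 : ((c.val * 2 ^ s.length + natOfStr s : ℕ) : ℤ) * 2 ^ (k - 2 - s.length)
      = ((c.val * 2 ^ (k - 2) + natOfStr (firstStr (k - 2) s) : ℕ) : ℤ) := by
    unfold firstStr; rw [f1, ← hpow]; push_cast; ring
  have g2 : ((c.val * 2 ^ s.length + natOfStr s : ℕ) : ℤ) * 2 ^ (k - 2 - s.length)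
      + 2 ^ (k - 2 - s.length)
      = ((c.val * 2 ^ (k - 2) + natOfStr (lastStr (k - 2) s) + 1 : ℕ) : ℤ) := by
    unfold lastStr; rw [add_assoc (c.val * _), f2, ← hpow]; push_cast; ring
  have lf := idx_lt c (firstStr (k - 2) s)
  have ll := idx_lt c (lastStr (k - 2) s)
  have sf := node2At_eq c (firstStr (k - 2) s)
  have sl := node2At_eq c (lastStr (k - 2) s)
  rw [firstStr_length hsk] at lf sf
  rw [lastStr_length hsk] at ll sl
  have ls := idx_lt c s
  have ss := node2At_eq c s
  have hpos : 0 < 3 * 2 ^ (k - 2) := by positivity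
  rw [g2, g1] at l
  rw [g2, g1] at r
  rw [show ((c.val * 2 ^ (k - 2) + natOfStr (lastStr (k - 2) s) + 1 : ℕ) : ℤ) - 1
    = ((c.val * 2 ^ (k - 2) + natOfStr (lastStr (k - 2) s) : ℕ) : ℤ) by push_cast; ring] at l r
  simp only [toNat_natCast_emod, toNat_pred_emod _ _ hpos, Nat.sub_zero,
    Nat.mod_eq_of_lt lf, Nat.mod_eq_of_lt ll, Nat.mod_eq_of_lt ls, sf, sl, ss,
    show k - 2 - (k - 2 - s.length) = s.length by omega] at l r
  exact ⟨l, r⟩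

/-- (Lemma 4.) For a nested almost convex set, every nested, adoptable
labeling is well laid. -/
theorem nested_adoptable_wellLaid (X : Set Pt) (hX : IsNACS X) (k : ℕ)
    (hk : HasLayers X k) :
    (∀ x : List Bool → Pt, IsLabeling1 k X x → Nested1 k X x → Adoptable1 k X x →
      WellLaid1 k x) ∧
    (∀ x : Node2 → Pt, IsLabeling2 k X x → Nested2 k X x → Adoptable2 k X x →
      WellLaid2 k x) := by
  exact ⟨wellLaid1 X hX k hk, wellLaid2 X hX k hk⟩
end
end

section
/- For every integer k ≥ 1 there exists a nested almost convex set X ⊆ ℝ² with |X| = 3·2^(k−1) − 2 such that every point of X has integer coordinates of absolute value at most 2·5^(k+1). -/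
open Set

noncomputable section

namespace NacsAux

/-- The two contractions of a corner. -/
def f : Bool → Pt → Pt
  | false, p => ((1 + p.1 - p.2) / 5, p.2 / 5)
  | true, p => (p.1 / 5, (1 + p.2 - p.1) / 5)

def ff (s : List Bool) (p : Pt) : Pt := s.foldr f p

def x0 : Pt := (16 / 125, 16 / 125)

def g (s : List Bool) : Pt := ff s x0

/-- The three corner charts. -/
def phi : Fin 3 → Pt → Pt
  | 0, p => (1 - p.1 - 2 * p.2, p.1 - p.2)
  | 1, p => (p.2 - p.1, 1 - 2 * p.1 - p.2)
  | 2, p => (2 * p.1 + p.2 - 1, p.1 + 2 * p.2 - 1)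

def pt : Node2 → Pt
  | none => (0, 0)
  | some (c, s) => phi c (g s)

def KK (p : Pt) : Prop := 0 ≤ p.1 ∧ 0 ≤ p.2 ∧ 1 / 5 ≤ p.1 + p.2 ∧ p.1 + p.2 ≤ 32 / 125

def OO (p : Pt) : Prop := 0 ≤ p.1 ∧ 0 ≤ p.2 ∧ 13 / 20 ≤ p.1 + p.2

lemma f_K (b : Bool) (p : Pt) (h : KK p) : KK (f b p) := by
  obtain ⟨h1, h2, h3, h4⟩ := h
  cases b <;> simp only [f, KK] <;> refine ⟨?_, ?_, ?_, ?_⟩ <;> linarith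

lemma x0_K : KK x0 := by
  simp only [x0, KK]; norm_num

lemma g_K (s : List Bool) : KK (g s) := by
  induction s with
  | nil => exact x0_K
  | cons b s ih => exact f_K b _ ih

lemma O_f (b : Bool) (p : Pt) (h : OO p) : ∃ o, OO o ∧ p = f b o := by
  obtain ⟨h1, h2, h3⟩ := h
  cases b
  · refine ⟨(5 * p.1 + 5 * p.2 - 1, 5 * p.2), ⟨?_, ?_, ?_⟩, ?_⟩
    · dsimp only; linarith
    · dsimp only; linarith
    · dsimp only; linarith
    · ext <;> simp only [f] <;> ring
  · refine ⟨(5 * p.1, 5 * p.1 + 5 * p.2 - 1), ⟨?_, ?_, ?_⟩, ?_⟩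
    · dsimp only; linarith
    · dsimp only; linarith
    · dsimp only; linarith
    · ext <;> simp only [f] <;> ring

lemma x0_f (b : Bool) : ∃ o, OO o ∧ x0 = f b o := by
  cases b
  · refine ⟨(5 * x0.1 + 5 * x0.2 - 1, 5 * x0.2), ?_, ?_⟩
    · simp only [OO, x0]; norm_num
    · ext <;> simp only [f] <;> ring
  · refine ⟨(5 * x0.1, 5 * x0.1 + 5 * x0.2 - 1), ?_, ?_⟩
    · simp only [OO, x0]; norm_num
    · ext <;> simp only [f] <;> ring

lemma K_f (b b' : Bool) (hb : b' ≠ b) (p : Pt) (h : KK p) : ∃ o, OO o ∧ f b' p = f b o := by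
  obtain ⟨h1, h2, h3, h4⟩ := h
  cases b <;> cases b' <;> simp at hb
  · refine ⟨(5 * (f true p).1 + 5 * (f true p).2 - 1, 5 * (f true p).2), ?_, ?_⟩
    · simp only [OO, f]; refine ⟨?_, ?_, ?_⟩ <;> linarith
    · ext <;> simp only [f] <;> ring
  · refine ⟨(5 * (f false p).1, 5 * (f false p).1 + 5 * (f false p).2 - 1), ?_, ?_⟩
    · simp only [OO, f]; refine ⟨?_, ?_, ?_⟩ <;> linarith
    · ext <;> simp only [f] <;> ring

lemma orient_f (b : Bool) (p q r : Pt) :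
    orient (f b p) (f b q) (f b r) = 1 / 25 * orient p q r := by
  cases b <;> simp only [f, orient] <;> ring

lemma orient_ff (s : List Bool) : ∃ κ : ℝ, 0 < κ ∧ ∀ p q r : Pt,
    orient (ff s p) (ff s q) (ff s r) = κ * orient p q r := by
  induction s with
  | nil => exact ⟨1, one_pos, fun p q r => by simp [ff]⟩
  | cons b s ih =>
    obtain ⟨κ, hκ, h⟩ := ih
    refine ⟨1 / 25 * κ, by positivity, fun p q r => ?_⟩
    change orient (f b (ff s p)) (f b (ff s q)) (f b (ff s r)) = _
    rw [orient_f, h]; ring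

lemma orient_phi (c : Fin 3) (p q r : Pt) :
    orient (phi c p) (phi c q) (phi c r) = 3 * orient p q r := by
  fin_cases c <;> simp only [phi, orient] <;> ring

lemma ff_append (s t : List Bool) (p : Pt) : ff (s ++ t) p = ff s (ff t p) := by
  simp [ff]

/-- Other corners and the centre lie in the outer region. -/
lemma out_base (c : Fin 3) (y : Node2) (hy : ∀ t, y ≠ some (c, t)) :
    ∃ o, OO o ∧ pt y = phi c o := by
  rcases y with _ | ⟨d, t⟩
  · refine ⟨(1 / 3, 1 / 3), ⟨by norm_num, by norm_num, by norm_num⟩, ?_⟩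
    fin_cases c <;> simp only [pt, phi] <;> norm_num
  · have hd : d ≠ c := by
      rintro rfl; exact hy t rfl
    obtain ⟨h1, h2, h3, h4⟩ := g_K t
    have key : (∃ o, OO o ∧ o = ((g t).2, 1 - (g t).1 - (g t).2)) ∧
        (∃ o, OO o ∧ o = (1 - (g t).1 - (g t).2, (g t).1)) := by
      refine ⟨⟨_, ⟨?_, ?_, ?_⟩, rfl⟩, ⟨_, ⟨?_, ?_, ?_⟩, rfl⟩⟩ <;> dsimp only <;> linarith
    obtain ⟨⟨o1, ho1, e1⟩, ⟨o2, ho2, e2⟩⟩ := key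
    fin_cases c <;> fin_cases d <;> simp at hd <;>
    first
    | (refine ⟨o1, ho1, ?_⟩; subst e1; ext <;> simp only [pt, phi] <;> ring1)
    | (refine ⟨o2, ho2, ?_⟩; subst e2; ext <;> simp only [pt, phi] <;> ring1)

lemma out_all (c : Fin 3) (s : List Bool) : ∀ y : Node2, (∀ t, y ≠ some (c, s ++ t)) →
    ∃ o, OO o ∧ pt y = phi c (ff s o) := by
  induction s using List.reverseRecOn with
  | nil => intro y hy; exact out_base c y (by simpa using hy)
  | append_singleton s b ih =>
    intro y hy
    by_cases h : ∀ t, y ≠ some (c, s ++ t)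
    · obtain ⟨o, ho, e⟩ := ih y h
      obtain ⟨o', ho', e'⟩ := O_f b o ho
      refine ⟨o', ho', ?_⟩
      rw [e, e', ff_append]; rfl
    · push Not at h
      obtain ⟨t, rfl⟩ := h
      rcases t with _ | ⟨b', t⟩
      · obtain ⟨o', ho', e'⟩ := x0_f b
        refine ⟨o', ho', ?_⟩
        simp only [pt, g, List.append_nil]
        rw [ff_append]; conv_lhs => rw [e']
        rfl
      · have hb : b' ≠ b := by
          rintro rfl
          exact hy t (by simp)
        obtain ⟨o', ho', e'⟩ := K_f b b' hb (g t) (g_K t)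
        refine ⟨o', ho', ?_⟩
        simp only [pt, g]
        rw [ff_append, ff_append]
        change phi c (ff s (f b' (g t))) = _
        rw [e']; rfl

lemma loc_tf (p q : Pt) (hp : KK p) (hq : KK q) : 0 < orient (f true p) (f false q) x0 := by
  obtain ⟨h1, h2, h3, h4⟩ := hp
  obtain ⟨k1, k2, k3, k4⟩ := hq
  simp only [orient, f, x0]
  nlinarith [mul_nonneg h1 k1, mul_nonneg h1 k2, mul_nonneg h2 k1, mul_nonneg h2 k2,
    mul_nonneg h1 (sub_nonneg.2 k4), mul_nonneg h2 (sub_nonneg.2 k4),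
    mul_nonneg k1 (sub_nonneg.2 h4), mul_nonneg k2 (sub_nonneg.2 h4),
    mul_nonneg (sub_nonneg.2 h4) (sub_nonneg.2 k4),
    mul_nonneg (sub_nonneg.2 h3) (sub_nonneg.2 k4),
    mul_nonneg (sub_nonneg.2 h4) (sub_nonneg.2 k3),
    mul_nonneg (sub_nonneg.2 h3) (sub_nonneg.2 k3)]

lemma loc_fo (p q : Pt) (hp : KK p) (hq : OO q) : 0 < orient (f false p) q x0 := by
  obtain ⟨h1, h2, h3, h4⟩ := hp
  obtain ⟨k1, k2, k3⟩ := hq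
  simp only [orient, f, x0]
  nlinarith [mul_nonneg h1 k1, mul_nonneg h1 k2, mul_nonneg h2 k1, mul_nonneg h2 k2,
    mul_nonneg h1 (sub_nonneg.2 k3), mul_nonneg h2 (sub_nonneg.2 k3),
    mul_nonneg k1 (sub_nonneg.2 h4), mul_nonneg k2 (sub_nonneg.2 h4),
    mul_nonneg k1 (sub_nonneg.2 h3), mul_nonneg k2 (sub_nonneg.2 h3),
    mul_nonneg (sub_nonneg.2 h4) (sub_nonneg.2 k3),
    mul_nonneg (sub_nonneg.2 h3) (sub_nonneg.2 k3)]

lemma loc_ot (p q : Pt) (hp : KK p) (hq : OO q) : 0 < orient q (f true p) x0 := by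
  have h := loc_fo (p.2, p.1) (q.2, q.1)
    ⟨hp.2.1, hp.1, by linarith [hp.2.2.1], by linarith [hp.2.2.2]⟩
    ⟨hq.2.1, hq.1, by linarith [hq.2.2]⟩
  simp only [orient, f, x0] at h ⊢
  linarith

lemma loc_root (c : Fin 3) (p q : Pt) (hp : KK p) (hq : KK q) :
    0 < orient (phi c p) (phi (c + 1) q) (0, 0) := by
  obtain ⟨h1, h2, h3, h4⟩ := hp
  obtain ⟨k1, k2, k3, k4⟩ := hq
  fin_cases c <;> simp [phi, orient] <;>
  nlinarith [mul_nonneg h1 k1, mul_nonneg h1 k2, mul_nonneg h2 k1, mul_nonneg h2 k2,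
    mul_nonneg h1 (sub_nonneg.2 k4), mul_nonneg h2 (sub_nonneg.2 k4),
    mul_nonneg k1 (sub_nonneg.2 h4), mul_nonneg k2 (sub_nonneg.2 h4),
    mul_nonneg (sub_nonneg.2 h4) (sub_nonneg.2 k4)]

/-! Combinatorics of the tree. -/

def sideL : List Bool → List Bool → Fin 3
  | [], [] => 2
  | [], b :: _ => if b then 0 else 1
  | _ :: _, [] => 2
  | a :: s, b :: t => if a = b then sideL s t else 2

def side : Node2 → Node2 → Fin 3
  | none, none => 2
  | none, some (c, _) => c
  | some _, none => 2
  | some (c, s), some (d, t) => if c = d then sideL s t else 2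

def lev : Node2 → ℕ
  | none => 0
  | some (_, s) => s.length + 1

lemma sideL_spec (s t : List Bool) : t = s ∨ (sideL s t = 0 ∧ ∃ r, t = s ++ true :: r) ∨
    (sideL s t = 1 ∧ ∃ r, t = s ++ false :: r) ∨ (sideL s t = 2 ∧ ∀ r, t ≠ s ++ r) := by
  induction s generalizing t with
  | nil => rcases t with _ | ⟨b, t⟩
           · simp
           · cases b <;> simp [sideL]
  | cons a s ih =>
    rcases t with _ | ⟨b, t⟩
    · simp [sideL]
    · by_cases h : a = b
      · subst h
        simpa [sideL] using ih t
      · have h' : b ≠ a := fun e => h e.symm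
        simp [sideL, h, h']

lemma side_spec (c : Fin 3) (s : List Bool) (y : Node2) (hy : y ≠ some (c, s)) :
    (side (some (c, s)) y = 0 ∧ ∃ r, y = some (c, s ++ true :: r)) ∨
    (side (some (c, s)) y = 1 ∧ ∃ r, y = some (c, s ++ false :: r)) ∨
    (side (some (c, s)) y = 2 ∧ ∀ r, y ≠ some (c, s ++ r)) := by
  rcases y with _ | ⟨d, t⟩
  · simp [side]
  · by_cases h : c = d
    · subst h
      rcases sideL_spec s t with h | h | h | h
      · subst h; exact absurd rfl hy
      · simpa [side] using Or.inl h
      · simpa [side] using Or.inr (Or.inl h)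
      · simpa [side] using Or.inr (Or.inr h)
    · have h' : d ≠ c := fun e => h e.symm
      simp [side, h, h']

lemma star (u a b : Node2) (ha : a ≠ u) (hb : b ≠ u) (h : side u b = side u a + 1) :
    0 < orient (pt a) (pt b) (pt u) := by
  rcases u with _ | ⟨c, s⟩
  · rcases a with _ | ⟨d, t⟩
    · simp at ha
    rcases b with _ | ⟨d', t'⟩
    · simp at hb
    simp only [side] at h
    subst h
    exact loc_root d _ _ (g_K t) (g_K t')
  · obtain ⟨κ, hκ, hs⟩ := orient_ff s
    have hx : pt (some (c, s)) = phi c (ff s x0) := rfl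
    have hc : ∀ (b : Bool) r, pt (some (c, s ++ b :: r)) = phi c (ff s (f b (g r))) := by
      intro b r
      simp only [pt, g]
      rw [ff_append]; rfl
    have fin : ∀ p q : Pt, 0 < orient p q x0 →
        0 < orient (phi c (ff s p)) (phi c (ff s q)) (phi c (ff s x0)) := by
      intro p q hpq
      rw [orient_phi, hs]; positivity
    rcases side_spec c s a ha with ⟨ea, r, rfl⟩ | ⟨ea, r, rfl⟩ | ⟨ea, ra⟩ <;>
    rcases side_spec c s b hb with ⟨eb, r', rfl⟩ | ⟨eb, r', rfl⟩ | ⟨eb, rb⟩ <;>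
    rw [ea, eb] at h <;> first | (exact absurd h (by decide)) | skip
    · rw [hc, hc, hx]; exact fin _ _ (loc_tf _ _ (g_K _) (g_K _))
    · obtain ⟨o, ho, e⟩ := out_all c s b rb
      rw [hc, e, hx]; exact fin _ _ (loc_fo _ _ (g_K _) ho)
    · obtain ⟨o, ho, e⟩ := out_all c s a ra
      rw [hc, e, hx]; exact fin _ _ (loc_ot _ _ (g_K _) ho)

lemma sideL_len (s t : List Bool) (h : t.length ≤ s.length) : sideL s t = 2 := by
  rcases sideL_spec s t with h' | ⟨_, r, rfl⟩ | ⟨_, r, rfl⟩ | h'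
  · subst h'
    clear h
    induction t with
    | nil => rfl
    | cons a s ih => simpa [sideL] using ih
  · simp at h
  · simp at h
  · exact h'.1

lemma side_lev (u y : Node2) (hy : y ≠ u) (h : lev y ≤ lev u) : side u y = 2 := by
  rcases u with _ | ⟨c, s⟩ <;> rcases y with _ | ⟨d, t⟩
  · simp at hy
  · simp [lev] at h
  · rfl
  · simp only [lev] at h
    simp only [side]
    split_ifs
    · exact sideL_len _ _ (by omega)
    · rfl

lemma sideL_swap (u v y : List Bool) (huv : u ≠ v) (hu : y ≠ u) (hv : y ≠ v)
    (h : sideL u y ≠ sideL u v) : sideL v y = sideL v u := by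
  induction u generalizing v y with
  | nil =>
    rcases v with _ | ⟨b, v⟩
    · simp at huv
    rcases y with _ | ⟨b', y⟩
    · simp at hu
    simp only [sideL] at h ⊢
    have : b ≠ b' := by rintro rfl; exact h rfl
    simp [this]
  | cons a u ih =>
    rcases v with _ | ⟨b, v⟩
    · rcases y with _ | ⟨b', y⟩
      · simp at hv
      simp only [sideL] at h ⊢
      have : a = b' := by
        by_contra h'; simp [h'] at h
      simp [this]
    · rcases y with _ | ⟨b', y⟩
      · simp only [sideL] at h ⊢
        have : a = b := by
          by_contra h'; simp [h'] at h
        subst this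
        simp only [ite_true] at h ⊢
        rcases sideL_spec u v with h' | ⟨e, r, rfl⟩ | ⟨e, r, rfl⟩ | h'
        · subst h'; simp at huv
        · exact (sideL_len _ _ (by simp)).symm
        · exact (sideL_len _ _ (by simp)).symm
        · exact absurd h'.1.symm h
      · simp only [sideL] at h ⊢
        by_cases h1 : a = b
        · subst h1
          by_cases h2 : a = b'
          · subst h2
            simp only [ite_true] at h ⊢
            exact ih v y (by simpa using huv) (by simpa using hu) (by simpa using hv) h
          · simp only [ite_true, h2, ite_false] at h ⊢
            rcases sideL_spec u v with h' | ⟨e, r, rfl⟩ | ⟨e, r, rfl⟩ | h'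
            · subst h'; simp at huv
            · exact (sideL_len _ _ (by simp)).symm
            · exact (sideL_len _ _ (by simp)).symm
            · exact absurd h'.1.symm h
        · have h1' : b ≠ a := fun e => h1 e.symm
          by_cases h2 : a = b'
          · subst h2; simp [h1']
          · simp [h1, h2] at h

lemma side_swap (u v y : Node2) (huv : u ≠ v) (hu : y ≠ u) (hv : y ≠ v)
    (h : side u y ≠ side u v) : side v y = side v u := by
  have key : ∀ (s t : List Bool), s ≠ t → sideL s t ≠ 2 → sideL t s = 2 := by
    intro s t hst h
    rcases sideL_spec s t with h' | ⟨e, r, rfl⟩ | ⟨e, r, rfl⟩ | h'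
    · exact absurd h'.symm hst
    · exact sideL_len _ _ (by simp)
    · exact sideL_len _ _ (by simp)
    · exact absurd h'.1 h
  rcases u with _ | ⟨c, s⟩ <;> rcases v with _ | ⟨d, t⟩ <;> rcases y with _ | ⟨e, r⟩ <;>
    simp only [side] at h ⊢ <;> simp at huv hu hv
  · have : d ≠ e := fun e' => h e'.symm
    simp [this]
  · by_contra h'
    have : c ≠ e := fun e' => h' e'.symm
    simp [this] at h
  · by_cases h1 : c = d
    · subst h1
      simp only [ite_true] at h ⊢
      exact (key s t (by simpa using huv) h.symm).symm
    · simp [h1] at h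
  · by_cases h1 : c = d
    · subst h1
      by_cases h2 : c = e
      · subst h2
        simp only [ite_true] at h ⊢
        exact sideL_swap s t r (by simpa using huv) (by simpa using hu) (by simpa using hv) h
      · simp only [ite_true, h2, ite_false] at h ⊢
        exact (key s t (by simpa using huv) h.symm).symm
    · have h1' : d ≠ c := fun e => h1 e.symm
      by_cases h2 : c = e
      · subst h2; simp [h1']
      · simp [h1, h2] at h

/-- pairwise separation by `m`. -/
def SepL (m a b : List Bool) : Prop := a ≠ m → b ≠ m → sideL m a ≠ sideL m b

def Sep (m a b : Node2) : Prop := a ≠ m → b ≠ m → side m a ≠ side m b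

lemma lca (a b : List Bool) (hab : a ≠ b) : ∃ m, SepL m a b ∧ (a ≠ m → sideL m a ≠ 2) ∧
    (b ≠ m → sideL m b ≠ 2) := by
  induction a generalizing b with
  | nil =>
    rcases b with _ | ⟨b0, b⟩
    · simp at hab
    exact ⟨[], by simp [SepL], by simp, by cases b0 <;> simp [sideL]⟩
  | cons a0 a ih =>
    rcases b with _ | ⟨b0, b⟩
    · exact ⟨[], by simp [SepL], by cases a0 <;> simp [sideL], by simp⟩
    by_cases h : a0 = b0
    · subst h
      obtain ⟨m, h1, h2, h3⟩ := ih b (by simpa using hab)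
      refine ⟨a0 :: m, ?_, ?_, ?_⟩
      · simpa [SepL, sideL] using h1
      · simpa [sideL] using h2
      · simpa [sideL] using h3
    · refine ⟨[], ?_, ?_, ?_⟩ <;> cases a0 <;> cases b0 <;> simp [SepL, sideL] at h ⊢

lemma lcaN (c : Fin 3) (a b : List Bool) (hab : a ≠ b) (y : Node2) (hy : ∀ t, y ≠ some (c, t)) :
    ∃ m, Sep m (some (c, a)) (some (c, b)) ∧ Sep m (some (c, a)) y ∧ Sep m (some (c, b)) y := by
  obtain ⟨m, h1, h2, h3⟩ := lca a b hab
  have : side (some (c, m)) y = 2 := by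
    rcases y with _ | ⟨d, t⟩
    · rfl
    · have : c ≠ d := by rintro rfl; exact hy t rfl
      simp [side, this]
  refine ⟨some (c, m), ?_, ?_, ?_⟩
  · simpa [Sep, side, SepL] using h1
  · intro h _; rw [this]; simpa [side] using h2 (by simpa using h)
  · intro h _; rw [this]; simpa [side] using h3 (by simpa using h)

lemma lcaC (c : Bool) (a b : List Bool) (hab : a ≠ b) (y : List Bool) (hy : ∀ t, y ≠ c :: t) :
    ∃ m, SepL m (c :: a) (c :: b) ∧ SepL m (c :: a) y ∧ SepL m (c :: b) y := by
  obtain ⟨m, h1, h2, h3⟩ := lca a b hab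
  have : sideL (c :: m) y = 2 := by
    rcases y with _ | ⟨d, t⟩
    · rfl
    · have : c ≠ d := by rintro rfl; exact hy t rfl
      simp [sideL, this]
  refine ⟨c :: m, ?_, ?_, ?_⟩
  · simpa [sideL, SepL] using h1
  · intro h _; rw [this]; simpa [sideL] using h2 (by simpa using h)
  · intro h _; rw [this]; simpa [sideL] using h3 (by simpa using h)

lemma SepL.symm {m a b : List Bool} (h : SepL m a b) : SepL m b a :=
  fun h1 h2 => (h h2 h1).symm

lemma Sep.symm {m a b : Node2} (h : Sep m a b) : Sep m b a :=
  fun h1 h2 => (h h2 h1).symm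

lemma medL (a b c : List Bool) (hab : a ≠ b) (hac : a ≠ c) (hbc : b ≠ c) :
    ∃ m, SepL m a b ∧ SepL m a c ∧ SepL m b c := by
  have one : ∀ b c : List Bool, b ≠ [] → c ≠ [] → b ≠ c →
      ∃ m, SepL m [] b ∧ SepL m [] c ∧ SepL m b c := by
    intro b c hb hc hbc
    rcases b with _ | ⟨b0, b⟩
    · simp at hb
    rcases c with _ | ⟨c0, c⟩
    · simp at hc
    by_cases h : b0 = c0
    · subst h
      obtain ⟨m, h1, h2, h3⟩ := lcaC b0 b c (by simpa using hbc) [] (by simp)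
      exact ⟨m, h2.symm, h3.symm, h1⟩
    · refine ⟨[], ?_, ?_, ?_⟩ <;> cases b0 <;> cases c0 <;> simp [SepL, sideL] at h ⊢
  induction a generalizing b c with
  | nil => exact one b c (Ne.symm hab) (Ne.symm hac) hbc
  | cons a0 a ih =>
    rcases b with _ | ⟨b0, b⟩
    · obtain ⟨m, h1, h2, h3⟩ := one (a0 :: a) c (by simp) (Ne.symm hbc) hac
      exact ⟨m, h1.symm, h3, h2⟩
    rcases c with _ | ⟨c0, c⟩
    · obtain ⟨m, h1, h2, h3⟩ := one (a0 :: a) (b0 :: b) (by simp) (by simp) hab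
      exact ⟨m, h3, h1.symm, h2.symm⟩
    by_cases h1 : a0 = b0
    · subst h1
      by_cases h2 : a0 = c0
      · subst h2
        obtain ⟨m, h1, h2, h3⟩ := ih b c (by simpa using hab) (by simpa using hac)
          (by simpa using hbc)
        refine ⟨a0 :: m, ?_, ?_, ?_⟩
        · simpa [SepL, sideL] using h1
        · simpa [SepL, sideL] using h2
        · simpa [SepL, sideL] using h3
      · obtain ⟨m, h1, h2, h3⟩ := lcaC a0 a b (by simpa using hab) (c0 :: c)
          (by intro t ht; simp at ht; exact h2 ht.1.symm)
        exact ⟨m, h1, h2, h3⟩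
    · by_cases h2 : a0 = c0
      · subst h2
        obtain ⟨m, h1, h2, h3⟩ := lcaC a0 a c (by simpa using hac) (b0 :: b)
          (by intro t ht; simp at ht; exact h1 ht.1.symm)
        exact ⟨m, h2, h1, h3.symm⟩
      · have h3 : b0 = c0 := by revert h1 h2; cases a0 <;> cases b0 <;> cases c0 <;> simp
        subst h3
        obtain ⟨m, h1, h2, h3⟩ := lcaC b0 b c (by simpa using hbc) (a0 :: a)
          (by intro t ht; simp at ht; exact h1 ht.1)
        exact ⟨m, h2.symm, h3.symm, h1⟩

lemma med (a b c : Node2) (hab : a ≠ b) (hac : a ≠ c) (hbc : b ≠ c) :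
    ∃ m, Sep m a b ∧ Sep m a c ∧ Sep m b c := by
  have one : ∀ b c : Node2, b ≠ none → c ≠ none → b ≠ c →
      ∃ m, Sep m none b ∧ Sep m none c ∧ Sep m b c := by
    intro b c hb hc hbc
    rcases b with _ | ⟨b0, b⟩
    · simp at hb
    rcases c with _ | ⟨c0, c⟩
    · simp at hc
    by_cases h : b0 = c0
    · subst h
      obtain ⟨m, h1, h2, h3⟩ := lcaN b0 b c (by simpa using hbc) none (by simp)
      exact ⟨m, h2.symm, h3.symm, h1⟩
    · refine ⟨none, ?_, ?_, ?_⟩ <;> simp [Sep, side, h]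
  rcases a with _ | ⟨a0, a⟩
  · exact one b c (Ne.symm hab) (Ne.symm hac) hbc
  rcases b with _ | ⟨b0, b⟩
  · obtain ⟨m, h1, h2, h3⟩ := one (some (a0, a)) c (by simp) (Ne.symm hbc) hac
    exact ⟨m, h1.symm, h3, h2⟩
  rcases c with _ | ⟨c0, c⟩
  · obtain ⟨m, h1, h2, h3⟩ := one (some (a0, a)) (some (b0, b)) (by simp) (by simp) hab
    exact ⟨m, h3, h1.symm, h2.symm⟩
  by_cases h1 : a0 = b0
  · subst h1
    by_cases h2 : a0 = c0
    · subst h2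
      obtain ⟨m, h1, h2, h3⟩ := medL a b c (by simpa using hab) (by simpa using hac)
        (by simpa using hbc)
      refine ⟨some (a0, m), ?_, ?_, ?_⟩
      · simpa [Sep, SepL, side] using h1
      · simpa [Sep, SepL, side] using h2
      · simpa [Sep, SepL, side] using h3
    · obtain ⟨m, h1, h2, h3⟩ := lcaN a0 a b (by simpa using hab) (some (c0, c))
        (by intro t ht; simp at ht; exact h2 ht.1.symm)
      exact ⟨m, h1, h2, h3⟩
  · by_cases h2 : a0 = c0
    · subst h2
      obtain ⟨m, h1, h2, h3⟩ := lcaN a0 a c (by simpa using hac) (some (b0, b))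
        (by intro t ht; simp at ht; exact h1 ht.1.symm)
      exact ⟨m, h2, h1, h3.symm⟩
    · by_cases h3 : b0 = c0
      · subst h3
        obtain ⟨m, h1, h2, h3⟩ := lcaN b0 b c (by simpa using hbc) (some (a0, a))
          (by intro t ht; simp at ht; exact h1 ht.1)
        exact ⟨m, h2.symm, h3.symm, h1⟩
      · refine ⟨none, ?_, ?_, ?_⟩ <;> simp [Sep, side, h1, h2, h3]

/-- every side of every node is inhabited, by a node at most one level further. -/
lemma side_ex (u : Node2) (i : Fin 3) : ∃ y, y ≠ u ∧ side u y = i ∧ lev y ≤ lev u + 1 := by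
  rcases u with _ | ⟨c, s⟩
  · exact ⟨some (i, []), by simp, rfl, by simp [lev]⟩
  · have h : ∀ (s : List Bool) b, sideL s (s ++ [b]) = if b then 0 else 1 := by
      intro s b
      induction s with
      | nil => rfl
      | cons a s ih => simpa [sideL] using ih
    fin_cases i
    · exact ⟨some (c, s ++ [true]), by simp, by simp [side, h], by simp [lev]⟩
    · exact ⟨some (c, s ++ [false]), by simp, by simp [side, h], by simp [lev]⟩
    · exact ⟨none, by simp, rfl, by simp [lev]⟩

/-! Geometry. -/

def xx (M : ℝ) (u : Node2) : Pt := (M * (pt u).1, M * (pt u).2)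

lemma star' {M : ℝ} (hM : 0 < M) (u a b : Node2) (ha : a ≠ u) (hb : b ≠ u)
    (h : side u b = side u a + 1) : 0 < orient (xx M a) (xx M b) (xx M u) := by
  have h1 := star u a b ha hb h
  have : orient (xx M a) (xx M b) (xx M u) = M ^ 2 * orient (pt a) (pt b) (pt u) := by
    simp only [orient, xx]; ring
  rw [this]; positivity

lemma xx_inj {M : ℝ} (hM : 0 < M) : Function.Injective (xx M) := by
  intro u v huv
  by_contra hne
  obtain ⟨w, hw, hs, _⟩ := side_ex u (side u v + 1)
  have := star' hM u v w (Ne.symm hne) hw hs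
  rw [huv] at this
  simp only [orient] at this
  linarith

lemma orient_swap (a b c : Pt) : orient b a c = - orient a b c := by
  simp only [orient]; ring

lemma orient_cyc (a b c : Pt) : orient b c a = orient a b c := by
  simp only [orient]; ring

lemma orient_sum (a b c p : Pt) :
    orient a b p + orient b c p + orient c a p = orient a b c := by
  simp only [orient]; ring

lemma fin3_cases (i j : Fin 3) (h : i ≠ j) : j = i + 1 ∨ i = j + 1 := by
  revert i j; decide

lemma fin3_third (i j k : Fin 3) (hij : i ≠ j) (hik : i ≠ k) (hjk : j ≠ k) :
    (j = i + 1 ∧ k = j + 1 ∧ i = k + 1) ∨ (i = j + 1 ∧ j = k + 1 ∧ k = i + 1) := by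
  fin_cases i <;> fin_cases j <;> fin_cases k <;> simp at hij hik hjk ⊢

lemma ne_of_sides {M : ℝ} (hM : 0 < M) (u a b : Node2) (ha : a ≠ u) (hb : b ≠ u)
    (h : side u a ≠ side u b) : orient (xx M a) (xx M b) (xx M u) ≠ 0 := by
  rcases fin3_cases _ _ h with h | h
  · exact (star' hM u a b ha hb h).ne'
  · have := star' hM u b a hb ha h
    rw [orient_swap] at this
    linarith

lemma genpos {M : ℝ} (hM : 0 < M) (a b c : Node2) (hab : a ≠ b) (hac : a ≠ c) (hbc : b ≠ c) :
    orient (xx M a) (xx M b) (xx M c) ≠ 0 := by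
  obtain ⟨m, h1, h2, h3⟩ := med a b c hab hac hbc
  by_cases hma : a = m
  · subst hma
    rw [← orient_cyc]
    exact ne_of_sides hM _ _ _ hab.symm hac.symm (h3 hab.symm hac.symm)
  by_cases hmb : b = m
  · subst hmb
    rw [← orient_cyc, ← orient_cyc]
    exact ne_of_sides hM _ _ _ hbc.symm hab (h2 hab hbc.symm).symm
  by_cases hmc : c = m
  · subst hmc
    exact ne_of_sides hM _ _ _ hac hbc (h1 hac hbc)
  rw [← orient_sum _ _ _ (xx M m)]
  rcases fin3_third _ _ _ (h1 hma hmb) (h2 hma hmc) (h3 hmb hmc) with ⟨e1, e2, e3⟩ | ⟨e1, e2, e3⟩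
  · have := star' hM m a b hma hmb e1
    have := star' hM m b c hmb hmc e2
    have := star' hM m c a hmc hma e3
    linarith
  · have k1 := star' hM m b a hmb hma e1
    have k2 := star' hM m c b hmc hmb e2
    have k3 := star' hM m a c hma hmc e3
    rw [orient_swap] at k1 k2 k3
    linarith

lemma tri_interior (a b c p : Pt) (h1 : 0 < orient a b p) (h2 : 0 < orient b c p)
    (h3 : 0 < orient c a p) : p ∈ interior (convexHull ℝ ({a, b, c} : Set Pt)) := by
  have hopen : IsOpen {p : Pt | 0 < orient a b p ∧ 0 < orient b c p ∧ 0 < orient c a p} := by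
    have hc : ∀ a b : Pt, Continuous (orient a b) := by
      intro a b; unfold orient; fun_prop
    exact (isOpen_lt continuous_const (hc _ _)).inter
      ((isOpen_lt continuous_const (hc _ _)).inter (isOpen_lt continuous_const (hc _ _)))
  refine interior_maximal ?_ hopen ⟨h1, h2, h3⟩
  rintro q ⟨q1, q2, q3⟩
  have hD := orient_sum a b c q
  have hDpos : 0 < orient a b c := by linarith
  have hconv : Convex ℝ (convexHull ℝ ({a, b, c} : Set Pt)) := convex_convexHull _ _
  rw [convexHull_insert (by simp), ]
  simp only [convexHull_pair, mem_convexJoin, mem_singleton_iff, exists_eq_left]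
  have hbc : 0 < orient a b q + orient c a q := by linarith
  refine ⟨(orient c a q / (orient a b q + orient c a q)) • b +
    (orient a b q / (orient a b q + orient c a q)) • c,
    ⟨_, _, by positivity, by positivity, by field_simp; ring, rfl⟩,
    orient b c q / orient a b c, (orient a b q + orient c a q) / orient a b c,
    by positivity, by positivity, by rw [← hD]; field_simp; ring, ?_⟩
  have e : orient a b c ≠ 0 := hDpos.ne'
  have e' := hbc.ne'
  rw [smul_add, smul_smul, smul_smul]
  have k1 : (orient a b q + orient c a q) / orient a b c *
      (orient c a q / (orient a b q + orient c a q)) = orient c a q / orient a b c := by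
    field_simp
  have k2 : (orient a b q + orient c a q) / orient a b c *
      (orient a b q / (orient a b q + orient c a q)) = orient a b q / orient a b c := by
    field_simp
  rw [k1, k2]
  ext
  · simp only [Prod.fst_add, Prod.smul_fst, smul_eq_mul]
    field_simp
    simp only [orient]; ring
  · simp only [Prod.snd_add, Prod.smul_snd, smul_eq_mul]
    field_simp
    simp only [orient]; ring

lemma orient_comb (c u p q : Pt) (s t : ℝ) (h : s + t = 1) :
    orient (s • p + t • q) c u = s * orient p c u + t * orient q c u := by
  obtain rfl : t = 1 - s := by linarith
  simp only [orient, Prod.fst_add, Prod.smul_fst, smul_eq_mul, Prod.snd_add, Prod.smul_snd]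
  ring

/-- A hull lies in an open half plane together with one boundary point. -/
lemma hull_half (S : Set Pt) (c u z : Pt) (ε : ℝ) (hz : orient z c u = 0)
    (h : ∀ s ∈ S, s = z ∨ 0 < ε * orient s c u) :
    ∀ s ∈ convexHull ℝ S, s = z ∨ 0 < ε * orient s c u := by
  have hconv : Convex ℝ {s : Pt | s = z ∨ 0 < ε * orient s c u} := by
    rw [convex_iff_forall_pos]
    rintro p hp q hq s t hs ht hst
    simp only [mem_ofPred_eq] at *
    rw [orient_comb _ _ _ _ _ _ hst]
    rcases hp with rfl | hp <;> rcases hq with rfl | hq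
    · left; rw [← add_smul, hst, one_smul]
    · right; rw [hz]; nlinarith [mul_pos ht hq]
    · right; rw [hz]; nlinarith [mul_pos hs hp]
    · right; nlinarith [mul_pos ht hq, mul_pos hs hp]
  exact fun s hs => convexHull_min (s := S) h hconv hs

/-- Points not trisecting are outside. -/
lemma not_in_tri {M : ℝ} (hM : 0 < M) (u a b c : Node2) (ha : a ≠ u) (hb : b ≠ u) (hc : c ≠ u)
    (hab : side u a = side u b) :
    xx M u ∉ convexHull ℝ ({xx M a, xx M b, xx M c} : Set Pt) := by
  intro hmem
  have hz : ∀ p : Node2, orient (xx M p) (xx M p) (xx M u) = 0 := by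
    intro p; simp only [orient]; ring
  have hu : ∀ p : Node2, orient (xx M u) (xx M p) (xx M u) = 0 := by
    intro p; simp only [orient]; ring
  by_cases hac : side u a = side u c
  · obtain ⟨d, hd, hs, _⟩ := side_ex u (side u a + 1)
    have := hull_half {xx M a, xx M b, xx M c} (xx M d) (xx M u) (xx M d) 1 (hz d) (by
      rintro s (rfl | rfl | rfl) <;> right <;> rw [one_mul]
      · exact star' hM u a d ha hd hs
      · exact star' hM u b d hb hd (hab ▸ hs)
      · exact star' hM u c d hc hd (hac ▸ hs)) _ hmem
    rw [hu] at this
    rcases this with h | h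
    · exact hd (xx_inj hM h).symm
    · simp at h
  · have : ∃ ε : ℝ, 0 < ε * orient (xx M a) (xx M c) (xx M u) ∧
        0 < ε * orient (xx M b) (xx M c) (xx M u) := by
      rcases fin3_cases _ _ hac with h | h
      · refine ⟨1, ?_, ?_⟩ <;> rw [one_mul]
        · exact star' hM u a c ha hc h
        · exact star' hM u b c hb hc (hab ▸ h)
      · refine ⟨-1, ?_, ?_⟩
        · have := star' hM u c a hc ha h
          rw [orient_swap] at this; linarith
        · have := star' hM u c b hc hb (hab ▸ h)
          rw [orient_swap] at this; linarith
    obtain ⟨ε, e1, e2⟩ := this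
    have := hull_half {xx M a, xx M b, xx M c} (xx M c) (xx M u) (xx M c) ε (hz c) (by
      rintro s (rfl | rfl | rfl)
      · exact Or.inr e1
      · exact Or.inr e2
      · exact Or.inl rfl) _ hmem
    rw [hu] at this
    rcases this with h | h
    · exact hc (xx_inj hM h).symm
    · simp at h

lemma in_tri {M : ℝ} (hM : 0 < M) (u a b c : Node2) (ha : a ≠ u) (hb : b ≠ u) (hc : c ≠ u)
    (hab : side u a ≠ side u b) (hac : side u a ≠ side u c) (hbc : side u b ≠ side u c) :
    xx M u ∈ interior (convexHull ℝ ({xx M a, xx M b, xx M c} : Set Pt)) := by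
  rcases fin3_third _ _ _ hab hac hbc with ⟨e1, e2, e3⟩ | ⟨e1, e2, e3⟩
  · exact tri_interior _ _ _ _ (star' hM u a b ha hb e1) (star' hM u b c hb hc e2)
      (star' hM u c a hc ha e3)
  · have := tri_interior _ _ _ _ (star' hM u a c ha hc e3) (star' hM u c b hc hb e2)
      (star' hM u b a hb ha e1)
    rwa [Set.pair_comm (xx M c) (xx M b)] at this

lemma sides_of_in {M : ℝ} (hM : 0 < M) (u a b c : Node2) (ha : a ≠ u) (hb : b ≠ u) (hc : c ≠ u)
    (h : xx M u ∈ convexHull ℝ ({xx M a, xx M b, xx M c} : Set Pt)) :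
    side u a ≠ side u b ∧ side u a ≠ side u c ∧ side u b ≠ side u c := by
  refine ⟨fun e => not_in_tri hM u a b c ha hb hc e h, fun e => ?_, fun e => ?_⟩
  · apply not_in_tri hM u a c b ha hc hb e
    rwa [Set.pair_comm (xx M c) (xx M b)]
  · apply not_in_tri hM u b c a hb hc ha e
    have : ({xx M b, xx M c, xx M a} : Set Pt) = {xx M a, xx M b, xx M c} := by
      ext; simp; tauto
    rwa [this]

lemma not_extreme_of_interior (A : Set Pt) (p : Pt) (h : p ∈ interior A) :
    p ∉ Set.extremePoints ℝ A := by
  intro he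
  have hcont : ContinuousAt (fun t : ℝ => ((p.1 + t, p.2) : Pt)) 0 := by fun_prop
  have hcont' : ContinuousAt (fun t : ℝ => ((p.1 - t, p.2) : Pt)) 0 := by fun_prop
  have hA : A ∈ nhds p := mem_interior_iff_mem_nhds.1 h
  have h1 := hcont.preimage_mem_nhds (t := A) (by simpa using hA)
  have h2 := hcont'.preimage_mem_nhds (t := A) (by simpa using hA)
  have h3 : ∀ᶠ t in nhdsWithin (0 : ℝ) (Ioi 0), t ∈ Ioi (0 : ℝ) := self_mem_nhdsWithin
  have h1' : ∀ᶠ t in nhdsWithin (0 : ℝ) (Ioi 0), ((p.1 + t, p.2) : Pt) ∈ A :=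
    nhdsWithin_le_nhds h1
  have h2' : ∀ᶠ t in nhdsWithin (0 : ℝ) (Ioi 0), ((p.1 - t, p.2) : Pt) ∈ A :=
    nhdsWithin_le_nhds h2
  obtain ⟨t, ⟨ht1, ht2⟩, ht⟩ := ((h1'.and h2').and h3).exists
  have := he.2 ht1 ht2 ⟨1 / 2, 1 / 2, by norm_num, by norm_num, by norm_num, by
    ext <;> simp <;> ring⟩
  have := congrArg Prod.fst this
  simp at this
  simp at ht
  linarith

def XL (M : ℝ) (j : ℕ) : Set Pt := xx M '' {u | lev u < j}

lemma ext_XL {M : ℝ} (hM : 0 < M) (j : ℕ) :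
    extremePts (XL M (j + 1)) = xx M '' {u | lev u = j} := by
  apply Set.Subset.antisymm
  · intro p hp
    have hp' : p ∈ XL M (j + 1) := extremePoints_convexHull_subset hp
    obtain ⟨u, hu, rfl⟩ := hp'
    refine ⟨u, ?_, rfl⟩
    simp only [mem_ofPred_eq] at hu ⊢
    by_contra hne
    refine not_extreme_of_interior _ _ ?_ hp
    obtain ⟨a, ha, sa, la⟩ := side_ex u 0
    obtain ⟨b, hb, sb, lb⟩ := side_ex u 1
    obtain ⟨c, hc, sc, lc⟩ := side_ex u 2
    refine interior_mono (convexHull_mono ?_) (in_tri hM u a b c ha hb hc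
      (by rw [sa, sb]; decide) (by rw [sa, sc]; decide) (by rw [sb, sc]; decide))
    rintro s (rfl | rfl | rfl)
    · exact ⟨a, by simp only [mem_ofPred_eq]; omega, rfl⟩
    · exact ⟨b, by simp only [mem_ofPred_eq]; omega, rfl⟩
    · exact ⟨c, by simp only [mem_ofPred_eq]; omega, rfl⟩
  · rintro _ ⟨u, hu, rfl⟩
    simp only [mem_ofPred_eq] at hu
    obtain ⟨b, hb, sb, _⟩ := side_ex u 0
    have hz : orient (xx M u) (xx M b) (xx M u) = 0 := by simp only [orient]; ring
    have key := hull_half (XL M (j + 1)) (xx M b) (xx M u) (xx M u) 1 hz (by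
      rintro _ ⟨y, hy, rfl⟩
      simp only [mem_ofPred_eq] at hy
      by_cases hyu : y = u
      · left; rw [hyu]
      · right
        rw [one_mul]
        refine star' hM u y b hyu hb ?_
        rw [sb, side_lev u y hyu (by omega)]; decide)
    refine ⟨subset_convexHull _ _ ⟨u, by simp only [mem_ofPred_eq]; omega, rfl⟩, ?_⟩
    rintro y hy z hz' ⟨s, t, hs, ht, hst, e⟩
    have h1 := orient_comb (xx M b) (xx M u) y z s t hst
    rw [e, hz] at h1
    have ky := key y hy
    have kz := key z hz'
    rw [one_mul] at ky kz
    rcases ky with ky | ky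
    · exact ky
    · exfalso
      have : 0 ≤ orient z (xx M b) (xx M u) := by
        rcases kz with kz | kz
        · rw [kz, hz]
        · exact kz.le
      nlinarith [mul_pos hs ky, mul_nonneg ht.le this]

lemma peel_XL {M : ℝ} (hM : 0 < M) (j : ℕ) : peel (XL M (j + 1)) = XL M j := by
  unfold peel
  rw [ext_XL hM, XL, ← Set.image_sdiff (xx_inj hM), XL]
  congr 1
  ext u
  simp only [mem_sdiff, mem_ofPred_eq]
  omega

lemma peel_iter {M : ℝ} (hM : 0 < M) (k i : ℕ) (hi : i ≤ k) : peel^[i] (XL M k) = XL M (k - i) := by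
  induction i with
  | zero => rfl
  | succ i ih =>
    obtain ⟨d, hd⟩ : ∃ d, k - i = d + 1 := ⟨k - i - 1, by omega⟩
    rw [Function.iterate_succ_apply', ih (by omega), hd, peel_XL hM]
    congr 1
    omega

lemma XL_zero (M : ℝ) : XL M 0 = ∅ := by simp [XL]

lemma XL_nonempty (M : ℝ) (j : ℕ) (hj : 1 ≤ j) : (XL M j).Nonempty :=
  ⟨xx M none, none, by simp [lev]; omega, rfl⟩

lemma hasLayers_unique {M : ℝ} (hM : 0 < M) (k k' : ℕ) (h : HasLayers (XL M k) k') : k' = k := by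
  obtain ⟨h1, h2⟩ := h
  rcases lt_trichotomy k' k with h | h | h
  · rw [peel_iter hM k k' h.le] at h1
    exact absurd h1 (XL_nonempty M _ (by omega)).ne_empty
  · exact h
  · exact absurd (by rw [peel_iter hM k k le_rfl, Nat.sub_self, XL_zero]) (h2 k h)

lemma nacs_layers {M : ℝ} (hM : 0 < M) (j : ℕ) (a b c : Node2) (ha : lev a = j) (hb : lev b = j)
    (hc : lev c = j) (hab : a ≠ b) (hac : a ≠ c) (hbc : b ≠ c) :
    ∃! p : Pt, p ∈ XL M j ∩ interior (convexHull ℝ ({xx M a, xx M b, xx M c} : Set Pt)) := by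
  obtain ⟨m, h1, h2, h3⟩ := med a b c hab hac hbc
  have hlt : lev m < j := by
    by_contra hle
    push Not at hle
    by_cases hma : a = m
    · subst hma
      exact h3 hab.symm hac.symm (by
        rw [side_lev _ _ hab.symm (by omega), side_lev _ _ hac.symm (by omega)])
    by_cases hmb : b = m
    · subst hmb
      exact h2 hab hbc.symm (by
        rw [side_lev _ _ hab (by omega), side_lev _ _ hbc.symm (by omega)])
    · exact h1 hma hmb (by
        rw [side_lev _ _ hma (by omega), side_lev _ _ hmb (by omega)])
  have ne : ∀ u y : Node2, lev u < j → lev y = j → y ≠ u := by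
    rintro u y h h' rfl; omega
  have hma := ne m a hlt ha
  have hmb := ne m b hlt hb
  have hmc := ne m c hlt hc
  refine ⟨xx M m, ⟨⟨m, hlt, rfl⟩, in_tri hM m a b c hma hmb hmc (h1 hma hmb) (h2 hma hmc)
    (h3 hmb hmc)⟩, ?_⟩
  rintro _ ⟨⟨u, hu, rfl⟩, hmem⟩
  simp only [mem_ofPred_eq] at hu
  have hua := ne u a hu ha
  have hub := ne u b hu hb
  have huc := ne u c hu hc
  obtain ⟨s1, s2, s3⟩ := sides_of_in hM u a b c hua hub huc (interior_subset hmem)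
  by_contra hne
  have hum : u ≠ m := fun e => hne (by rw [e])
  have sw := fun y h1 h2 => side_swap u m y hum h1 h2
  have ea := sw a hua hma
  have eb := sw b hub hmb
  have ec := sw c huc hmc
  have t1 := h1 hma hmb
  have t2 := h2 hma hmc
  have t3 := h3 hmb hmc
  by_cases q1 : side u a = side u m
  · exact t3 ((eb (by rw [← q1]; exact s1.symm)).trans (ec (by rw [← q1]; exact s2.symm)).symm)
  · by_cases q2 : side u b = side u m
    · exact t2 ((ea q1).trans (ec (by rw [← q2]; exact s3.symm)).symm)
    · exact t1 ((ea q1).trans (eb q2).symm)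

/-! Counting and integrality. -/

lemma card_lists (n : ℕ) : {s : List Bool | s.length = n}.Finite ∧
    {s : List Bool | s.length = n}.ncard = 2 ^ n := by
  have : {s : List Bool | s.length = n} = Set.range (fun v : List.Vector Bool n => v.toList) := by
    ext s
    simp only [mem_ofPred_eq, mem_range]
    exact ⟨fun h => ⟨⟨s, h⟩, rfl⟩, by rintro ⟨v, rfl⟩; exact v.toList_length⟩
  rw [this]
  refine ⟨Set.finite_range _, ?_⟩
  have hinj : Function.Injective (fun v : List.Vector Bool n => v.toList) :=
    fun a b h => Subtype.ext h
  rw [← Set.image_univ, Set.ncard_image_of_injective _ hinj,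
    Set.ncard_univ, Nat.card_eq_fintype_card, card_vector]
  simp

lemma card_lev (n : ℕ) : {u : Node2 | lev u = n + 1}.Finite ∧
    {u : Node2 | lev u = n + 1}.ncard = 3 * 2 ^ n := by
  have : {u : Node2 | lev u = n + 1} =
      some '' ((Set.univ : Set (Fin 3)) ×ˢ {s : List Bool | s.length = n}) := by
    ext u
    rcases u with _ | ⟨c, s⟩ <;> simp [lev]
  rw [this]
  obtain ⟨h1, h2⟩ := card_lists n
  refine ⟨(Set.finite_univ.prod h1).image _, ?_⟩
  rw [Set.ncard_image_of_injective _ (Option.some_injective _), Set.ncard_prod, h2, Set.ncard_univ]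
  simp

lemma card_lt (n : ℕ) : {u : Node2 | lev u < n + 1}.Finite ∧
    {u : Node2 | lev u < n + 1}.ncard = 3 * 2 ^ n - 2 := by
  induction n with
  | zero =>
    have : {u : Node2 | lev u < 0 + 1} = {none} := by
      ext u
      rcases u with _ | ⟨c, s⟩ <;> simp [lev]
    rw [this]
    simp
  | succ n ih =>
    have : {u : Node2 | lev u < n + 1 + 1} = {u | lev u < n + 1} ∪ {u | lev u = n + 1} := by
      ext u
      simp only [mem_ofPred_eq, mem_union]
      omega
    rw [this]
    obtain ⟨h1, h2⟩ := card_lev n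
    refine ⟨ih.1.union h1, ?_⟩
    rw [Set.ncard_union_eq _ ih.1 h1, ih.2, h2, pow_succ]
    · have : 1 ≤ 2 ^ n := Nat.one_le_two_pow
      omega
    · rw [Set.disjoint_left]
      intro u hu hu'
      simp only [mem_ofPred_eq] at hu hu'
      omega

lemma g_int (s : List Bool) (N : ℕ) (hN : s.length + 3 ≤ N) : ∃ a b : ℤ,
    (5 : ℝ) ^ N * (g s).1 = a ∧ (5 : ℝ) ^ N * (g s).2 = b := by
  induction s generalizing N with
  | nil =>
    obtain ⟨n, rfl⟩ := Nat.exists_eq_add_of_le' hN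
    refine ⟨5 ^ n * 16, 5 ^ n * 16, ?_⟩
    simp [g, ff, x0, pow_add]; ring
  | cons b s ih =>
    obtain ⟨n, rfl⟩ : ∃ n, N = n + 1 := ⟨N - 1, by simp at hN; omega⟩
    obtain ⟨A, B, h1, h2⟩ := ih n (by simp at hN; omega)
    have e : g (b :: s) = f b (g s) := rfl
    rw [e]
    cases b
    · refine ⟨5 ^ n + A - B, B, ?_⟩
      push_cast
      rw [← h1, ← h2]
      simp only [f, pow_succ]
      constructor <;> ring
    · refine ⟨A, 5 ^ n + B - A, ?_⟩
      push_cast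
      rw [← h1, ← h2]
      simp only [f, pow_succ]
      constructor <;> ring

lemma pt_bound (u : Node2) : |(pt u).1| ≤ 1 ∧ |(pt u).2| ≤ 1 := by
  rcases u with _ | ⟨c, s⟩
  · simp [pt]
  · obtain ⟨h1, h2, h3, h4⟩ := g_K s
    fin_cases c <;> simp only [pt, phi] <;> constructor <;> rw [abs_le] <;> constructor <;> linarith

lemma xx_int (N : ℕ) (u : Node2) (h : lev u + 2 ≤ N) : ∃ a b : ℤ,
    xx ((5 : ℝ) ^ N) u = ((a : ℝ), (b : ℝ)) ∧ |a| ≤ 5 ^ N ∧ |b| ≤ 5 ^ N := by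
  have key : ∃ a b : ℤ, xx ((5 : ℝ) ^ N) u = ((a : ℝ), (b : ℝ)) := by
    rcases u with _ | ⟨c, s⟩
    · exact ⟨0, 0, by simp [xx, pt]⟩
    · obtain ⟨A, B, h1, h2⟩ := g_int s N (by simp only [lev] at h; omega)
      fin_cases c
      · refine ⟨5 ^ N - A - 2 * B, A - B, ?_⟩
        push_cast; rw [← h1, ← h2]
        ext <;> simp only [xx, pt, phi] <;> ring
      · refine ⟨B - A, 5 ^ N - 2 * A - B, ?_⟩
        push_cast; rw [← h1, ← h2]
        ext <;> simp only [xx, pt, phi] <;> ring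
      · refine ⟨2 * A + B - 5 ^ N, A + 2 * B - 5 ^ N, ?_⟩
        push_cast; rw [← h1, ← h2]
        ext <;> simp only [xx, pt, phi] <;> ring
  obtain ⟨a, b, e⟩ := key
  refine ⟨a, b, e, ?_, ?_⟩
  · have e1 : (5 : ℝ) ^ N * (pt u).1 = a := congrArg Prod.fst e
    have : |(a : ℝ)| ≤ 5 ^ N := by
      rw [← e1, abs_mul, abs_of_pos (by positivity : (0 : ℝ) < 5 ^ N)]
      exact mul_le_of_le_one_right (by positivity) (pt_bound u).1
    exact_mod_cast this
  · have e1 : (5 : ℝ) ^ N * (pt u).2 = b := congrArg Prod.snd e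
    have : |(b : ℝ)| ≤ 5 ^ N := by
      rw [← e1, abs_mul, abs_of_pos (by positivity : (0 : ℝ) < 5 ^ N)]
      exact mul_le_of_le_one_right (by positivity) (pt_bound u).2
    exact_mod_cast this

end NacsAux

open NacsAux

/-- For every `k ≥ 1` there is a nested almost convex set with
`3·2^(k−1) − 2` points whose coordinates are integers of absolute value at most `2·5^(k+1)`. -/
theorem nacs_type2_small_drawing (k : ℕ) (hk : 1 ≤ k) :
    ∃ X : Set Pt, IsNACS X ∧ X.ncard = 3 * 2 ^ (k - 1) - 2 ∧
      ∀ p ∈ X, ∃ a b : ℤ, p = ((a : ℝ), (b : ℝ)) ∧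
        |a| ≤ 2 * 5 ^ (k + 1) ∧ |b| ≤ 2 * 5 ^ (k + 1) := by
  have hM : (0 : ℝ) < 5 ^ (k + 1) := by positivity
  obtain ⟨n, rfl⟩ : ∃ n, k = n + 1 := ⟨k - 1, by omega⟩
  refine ⟨XL (5 ^ (n + 1 + 1)) (n + 1), ⟨(card_lt n).1.image _, XL_nonempty _ _ (by omega), ?_, ?_⟩,
    ?_, ?_⟩
  · rintro _ ⟨a, _, rfl⟩ _ ⟨b, _, rfl⟩ _ ⟨c, _, rfl⟩ hab hac hbc
    exact genpos hM a b c (fun e => hab (by rw [e])) (fun e => hac (by rw [e]))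
      (fun e => hbc (by rw [e]))
  · intro k' hk' j hj1 hjk
    obtain rfl := hasLayers_unique hM _ _ hk'
    obtain ⟨j, rfl⟩ : ∃ i, j = i + 1 := ⟨j - 1, by omega⟩
    have e1 : layerSub (XL (5 ^ (n + 1 + 1)) (n + 1)) (n + 1) (j + 1) =
        XL (5 ^ (n + 1 + 1)) (j + 1) := by
      unfold layerSub
      rw [peel_iter hM _ _ (by omega)]
      congr 1; omega
    have e2 : layerSub (XL (5 ^ (n + 1 + 1)) (n + 1)) (n + 1) (j + 1 - 1) =
        XL (5 ^ (n + 1 + 1)) j := by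
      unfold layerSub
      rw [peel_iter hM _ _ (by omega)]
      congr 1; omega
    unfold layer
    rw [e1, e2, ext_XL hM]
    rintro _ ⟨a, ha, rfl⟩ _ ⟨b, hb, rfl⟩ _ ⟨c, hc, rfl⟩ hab hac hbc
    exact nacs_layers hM j a b c ha hb hc (fun e => hab (by rw [e])) (fun e => hac (by rw [e]))
      (fun e => hbc (by rw [e]))
  · rw [XL, Set.ncard_image_of_injective _ (xx_inj hM), (card_lt n).2]
    rfl
  · rintro _ ⟨u, hu, rfl⟩
    simp only [mem_ofPred_eq] at hu
    obtain ⟨a, b, e, ha, hb⟩ := xx_int (n + 1 + 1) u (by omega)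
    have : (0 : ℤ) < 5 ^ (n + 1 + 1) := by positivity
    exact ⟨a, b, e, by linarith, by linarith⟩
end
end
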